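/- Let g: ℕ → ℂ be additive, let X be large and α ∈ (1,2). Then the ℓ¹ prime-power discrepancy satisfies, for (log log X)/√(log X) < δ ≤ 1/4: ∑_{X^δ < p^k ≤ X} |g(p^k) − A_g(X) + A_g(X/p^k)| / p^k ≪_α (log(1/δ))^{1/2} · ((1/X) ∑_{n ≤ X} |g(n) − A_g(X)|^α)^{1/α} + B_g(X)/(log X)^{1/4}. -/

import Mathlib

open Finset

/-- The set of prime powers `p^k ≤ Y` (as natural numbers `≥ 2`). -/
noncomputable def ppows (Y : ℝ) : Finset ℕ :=
  (Finset.Icc 2 ⌊Y⌋₊).filter IsPrimePow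

/-- `A_g(Y) = ∑_{p^k ≤ Y} g(p^k) p^{-k} (1 - 1/p)`. -/
noncomputable def Ag (g : ℕ → ℂ) (Y : ℝ) : ℂ :=
  ∑ q ∈ ppows Y, g q * (1 / (q : ℂ)) * (1 - 1 / ((q.minFac : ℂ)))

/-- `B_g(Y) = (∑_{p^k ≤ Y} |g(p^k)|² p^{-k})^{1/2}`. -/
noncomputable def Bg (g : ℕ → ℂ) (Y : ℝ) : ℝ :=
  Real.sqrt (∑ q ∈ ppows Y, ‖g q‖ ^ 2 / (q : ℝ))

/-- `g` is additive: `g(mn) = g(m) + g(n)` whenever `gcd(m,n) = 1`. -/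
def IsAdditive (g : ℕ → ℂ) : Prop :=
  ∀ m n : ℕ, Nat.Coprime m n → g (m * n) = g m + g n

lemma exists_sq_mul_cube_eq {q : ℕ} (hq : IsPrimePow q) (hp : ¬ q.Prime) :
    ∃ a b : ℕ, 1 ≤ a ∧ 1 ≤ b ∧ a ^ 2 * b ^ 3 = q := by
  obtain ⟨p, k, hpp, hk, rfl⟩ := hq
  have hpr : p.Prime := hpp.nat_prime
  have hp1 : 1 ≤ p := hpr.one_le
  have hk1 : k ≠ 1 := by
    rintro rfl
    exact hp (by simpa using hpr)
  rcases Nat.even_or_odd' k with ⟨m, rfl | rfl⟩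
  · exact ⟨p ^ m, 1, Nat.one_le_pow _ _ hp1, le_rfl, by simp [← pow_mul, mul_comm]⟩
  · obtain ⟨j, rfl⟩ : ∃ j, m = j + 1 := ⟨m - 1, by omega⟩
    exact ⟨p ^ j, p, Nat.one_le_pow _ _ hp1, hp1, by ring⟩

/-- The prime powers up to `N`. -/
noncomputable def ppowsUpTo (N : ℕ) : Finset ℕ := (Icc 2 N).filter IsPrimePow

lemma mem_ppowsUpTo {N q : ℕ} : q ∈ ppowsUpTo N ↔ (2 ≤ q ∧ q ≤ N) ∧ IsPrimePow q := by
  simp [ppowsUpTo]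

/-- The primes in `(M, N]`. -/
def primesBetween (M N : ℕ) : Finset ℕ := (Ioc M N).filter Nat.Prime

lemma mem_primesBetween {M N p : ℕ} : p ∈ primesBetween M N ↔ (M < p ∧ p ≤ N) ∧ p.Prime := by
  simp [primesBetween]

lemma log_le_four_mul_rpow {x : ℝ} (hx : 0 ≤ x) : Real.log x ≤ 4 * x ^ ((1 : ℝ) / 4) := by
  have := Real.log_le_rpow_div hx (show (0 : ℝ) < 1 / 4 by norm_num)
  linarith

/-- `∑ log q / q` over proper prime powers is bounded. -/
lemma exists_sum_proper_log_div_le :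
    ∃ C : ℝ, 0 < C ∧ ∀ N : ℕ, ∑ q ∈ (ppowsUpTo N).filter (fun q => ¬ q.Prime),
      Real.log q / q ≤ C := by
  have hs1 : Summable (fun n : ℕ => 1 / (n : ℝ) ^ ((3 : ℝ) / 2)) :=
    Real.summable_one_div_nat_rpow.2 (by norm_num)
  have hs2 : Summable (fun n : ℕ => 1 / (n : ℝ) ^ ((9 : ℝ) / 4)) :=
    Real.summable_one_div_nat_rpow.2 (by norm_num)
  refine ⟨4 * ((∑' n : ℕ, 1 / (n : ℝ) ^ ((3 : ℝ) / 2)) *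
    (∑' n : ℕ, 1 / (n : ℝ) ^ ((9 : ℝ) / 4))) + 1, by positivity, fun N => ?_⟩
  classical
  have key : ∀ q ∈ (ppowsUpTo N).filter (fun q => ¬ q.Prime),
      ∃ ab : ℕ × ℕ, 1 ≤ ab.1 ∧ 1 ≤ ab.2 ∧ ab.1 ^ 2 * ab.2 ^ 3 = q := by
    intro q hq
    rw [mem_filter, mem_ppowsUpTo] at hq
    obtain ⟨a, b, h1, h2, h3⟩ := exists_sq_mul_cube_eq hq.1.2 hq.2
    exact ⟨(a, b), h1, h2, h3⟩
  choose! f hf1 hf2 hf3 using key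
  have hle : ∀ q ∈ (ppowsUpTo N).filter (fun q => ¬ q.Prime), f q ∈ Icc 1 N ×ˢ Icc 1 N := by
    intro q hq
    have h1 := hf1 q hq
    have h2 := hf2 q hq
    have h3 := hf3 q hq
    have hqN : q ≤ N := by
      rw [mem_filter, mem_ppowsUpTo] at hq
      exact hq.1.1.2
    have ha : (f q).1 ≤ q := by
      conv_rhs => rw [← h3]
      calc (f q).1 ≤ (f q).1 ^ 2 := Nat.le_self_pow (by norm_num) _
        _ ≤ _ := Nat.le_mul_of_pos_right _ (by positivity)
    have hb : (f q).2 ≤ q := by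
      conv_rhs => rw [← h3]
      calc (f q).2 ≤ (f q).2 ^ 3 := Nat.le_self_pow (by norm_num) _
        _ ≤ _ := Nat.le_mul_of_pos_left _ (by positivity)
    simp only [mem_product, mem_Icc]
    omega
  have hinj : Set.InjOn f ((ppowsUpTo N).filter (fun q => ¬ q.Prime)) := by
    intro q hq r hr h
    rw [← hf3 q hq, ← hf3 r hr, h]
  have hterm : ∀ q ∈ (ppowsUpTo N).filter (fun q => ¬ q.Prime), Real.log q / q ≤
      4 * (1 / ((f q).1 : ℝ) ^ ((3 : ℝ) / 2) * (1 / ((f q).2 : ℝ) ^ ((9 : ℝ) / 4))) := by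
    intro q hq
    have h1 := hf1 q hq
    have h2 := hf2 q hq
    have h3 := hf3 q hq
    set a := (f q).1
    set b := (f q).2
    have ha : (0 : ℝ) < a := by exact_mod_cast h1
    have hb : (0 : ℝ) < b := by exact_mod_cast h2
    have hq0 : (0 : ℝ) < q := by rw [← h3]; push_cast; positivity
    have hlog := log_le_four_mul_rpow hq0.le
    have h4 : (q : ℝ) ^ ((3 : ℝ) / 4) = (a : ℝ) ^ ((3 : ℝ) / 2) * (b : ℝ) ^ ((9 : ℝ) / 4) := by
      rw [← h3]
      push_cast
      rw [Real.mul_rpow (by positivity) (by positivity), ← Real.rpow_natCast, ← Real.rpow_natCast,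
        ← Real.rpow_mul ha.le, ← Real.rpow_mul hb.le]
      norm_num
    rw [one_div_mul_one_div, ← h4, div_le_iff₀ hq0]
    have h5 : (q : ℝ) = (q : ℝ) ^ ((1 : ℝ) / 4) * (q : ℝ) ^ ((3 : ℝ) / 4) := by
      rw [← Real.rpow_add hq0]; norm_num
    have h6 : (0 : ℝ) < (q : ℝ) ^ ((3 : ℝ) / 4) := by positivity
    calc Real.log q ≤ 4 * (q : ℝ) ^ ((1 : ℝ) / 4) := hlog
      _ = 4 * (1 / (q : ℝ) ^ ((3 : ℝ) / 4)) *
          ((q : ℝ) ^ ((1 : ℝ) / 4) * (q : ℝ) ^ ((3 : ℝ) / 4)) := by field_simp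
      _ = _ := by rw [← h5]
  calc _ ≤ ∑ q ∈ (ppowsUpTo N).filter (fun q => ¬ q.Prime),
      4 * (1 / ((f q).1 : ℝ) ^ ((3 : ℝ) / 2) * (1 / ((f q).2 : ℝ) ^ ((9 : ℝ) / 4))) :=
        sum_le_sum hterm
    _ = ∑ x ∈ ((ppowsUpTo N).filter (fun q => ¬ q.Prime)).image f,
      4 * (1 / (x.1 : ℝ) ^ ((3 : ℝ) / 2) * (1 / (x.2 : ℝ) ^ ((9 : ℝ) / 4))) := by
        rw [sum_image hinj]
    _ ≤ ∑ x ∈ Icc 1 N ×ˢ Icc 1 N,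
      4 * (1 / (x.1 : ℝ) ^ ((3 : ℝ) / 2) * (1 / (x.2 : ℝ) ^ ((9 : ℝ) / 4))) := by
        apply sum_le_sum_of_subset_of_nonneg
        · intro x hx
          obtain ⟨q, hq, rfl⟩ := mem_image.1 hx
          exact hle q hq
        · intros; positivity
    _ = 4 * ((∑ a ∈ Icc 1 N, 1 / (a : ℝ) ^ ((3 : ℝ) / 2)) *
          ∑ b ∈ Icc 1 N, 1 / (b : ℝ) ^ ((9 : ℝ) / 4)) := by
        rw [← mul_sum, sum_product, sum_mul_sum]
    _ ≤ 4 * ((∑' n : ℕ, 1 / (n : ℝ) ^ ((3 : ℝ) / 2)) *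
          (∑' n : ℕ, 1 / (n : ℝ) ^ ((9 : ℝ) / 4))) := by
        gcongr
        · exact hs1.sum_le_tsum _ (fun _ _ => by positivity)
        · exact hs2.sum_le_tsum _ (fun _ _ => by positivity)
    _ ≤ _ := by linarith

lemma filter_prime_ppowsUpTo (N : ℕ) :
    (ppowsUpTo N).filter Nat.Prime = primesBetween 1 N := by
  ext p
  simp only [mem_filter, mem_ppowsUpTo, mem_primesBetween]
  constructor
  · rintro ⟨⟨⟨h1, h2⟩, -⟩, h3⟩
    exact ⟨⟨h1, h2⟩, h3⟩
  · rintro ⟨⟨h1, h2⟩, h3⟩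
    exact ⟨⟨⟨h1, h2⟩, h3.isPrimePow⟩, h3⟩

/-- Chebyshev's bound for prime powers. -/
lemma exists_sum_log_ppowsUpTo_le :
    ∃ C : ℝ, 0 < C ∧ ∀ N : ℕ, ∑ q ∈ ppowsUpTo N, Real.log q ≤ C * N := by
  obtain ⟨C, hC, h⟩ := exists_sum_proper_log_div_le
  refine ⟨Real.log 4 + C, by positivity, fun N => ?_⟩
  rw [← sum_filter_add_sum_filter_not _ Nat.Prime, add_mul]
  refine add_le_add ?_ ?_
  · have := Chebyshev.theta_le_log4_mul_x (x := N) (by positivity)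
    rw [filter_prime_ppowsUpTo]
    refine le_trans (le_of_eq ?_) this
    rw [Chebyshev.theta, Nat.floor_natCast]
    apply sum_subset_zero_on_sdiff
    · intro p hp
      simp only [mem_primesBetween, mem_filter, mem_Ioc] at *
      exact ⟨⟨by omega, hp.1.2⟩, hp.2⟩
    · intro p hp
      simp only [mem_sdiff, mem_primesBetween, mem_filter, mem_Ioc] at hp
      exact absurd ⟨⟨hp.1.2.one_lt, hp.1.1.2⟩, hp.1.2⟩ hp.2
    · intros; rfl
  · refine le_trans ?_ (mul_le_mul_of_nonneg_right (h N) (Nat.cast_nonneg N))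
    rw [sum_mul]
    refine sum_le_sum fun q hq => ?_
    rw [mem_filter, mem_ppowsUpTo] at hq
    have hq0 : (0 : ℝ) < q := by exact_mod_cast (by omega : 0 < q)
    have hqN : (q : ℝ) ≤ N := by exact_mod_cast hq.1.1.2
    have hl : 0 ≤ Real.log q := Real.log_natCast_nonneg q
    rw [div_mul_eq_mul_div, le_div_iff₀ hq0]
    gcongr

lemma exists_sum_log_div_primes_le :
    ∃ C : ℝ, 0 < C ∧ ∀ N : ℕ, 1 ≤ N →
      ∑ p ∈ primesBetween 1 N, Real.log p / p ≤ Real.log N + C := by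
  obtain ⟨C, hC, h⟩ := exists_sum_log_ppowsUpTo_le
  refine ⟨C, hC, fun N hN => ?_⟩
  have hN0 : (0 : ℝ) < N := by exact_mod_cast hN
  have h1 : ∑ p ∈ primesBetween 1 N, Real.log p * ((N / p : ℕ) : ℝ) ≤ N * Real.log N := by
    calc _ = ∑ p ∈ primesBetween 1 N, ∑ n ∈ Ioc 0 N, if p ∣ n then Real.log p else 0 := by
          refine sum_congr rfl fun p hp => ?_
          rw [← Nat.Ioc_filter_dvd_card_eq_div, ← sum_filter, sum_const, nsmul_eq_mul, mul_comm]
      _ = ∑ n ∈ Ioc 0 N, ∑ p ∈ primesBetween 1 N, if p ∣ n then Real.log p else 0 := sum_comm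
      _ ≤ ∑ n ∈ Ioc 0 N, Real.log N := by
          refine sum_le_sum fun n hn => ?_
          rw [mem_Ioc] at hn
          calc _ = ∑ p ∈ (primesBetween 1 N).filter (· ∣ n), ArithmeticFunction.vonMangoldt p := by
                rw [sum_filter]
                refine sum_congr rfl fun p hp => ?_
                rw [mem_primesBetween] at hp
                rw [ArithmeticFunction.vonMangoldt_apply_prime hp.2]
            _ ≤ ∑ d ∈ n.divisors, ArithmeticFunction.vonMangoldt d := by
                apply sum_le_sum_of_subset_of_nonneg
                · intro p hp
                  rw [mem_filter] at hp
                  exact Nat.mem_divisors.2 ⟨hp.2, by omega⟩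
                · intros; exact ArithmeticFunction.vonMangoldt_nonneg
            _ = Real.log n := ArithmeticFunction.vonMangoldt_sum
            _ ≤ Real.log N := Real.log_le_log (by exact_mod_cast hn.1) (by exact_mod_cast hn.2)
      _ = _ := by simp
  have h2 : ∑ p ∈ primesBetween 1 N, Real.log p ≤ C * N := by
    refine le_trans ?_ (h N)
    rw [← filter_prime_ppowsUpTo]
    apply sum_le_sum_of_subset_of_nonneg (filter_subset _ _)
    intros; exact Real.log_natCast_nonneg _
  have h3 : N * ∑ p ∈ primesBetween 1 N, Real.log p / p ≤
      ∑ p ∈ primesBetween 1 N, (Real.log p * ((N / p : ℕ) : ℝ) + Real.log p) := by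
    rw [mul_sum]
    refine sum_le_sum fun p hp => ?_
    have hl : 0 ≤ Real.log p := Real.log_natCast_nonneg _
    have : (N : ℝ) / p ≤ ((N / p : ℕ) : ℝ) + 1 := by
      rw [← Nat.floor_div_eq_div (K := ℝ)]
      exact (Nat.lt_floor_add_one _).le
    calc (N : ℝ) * (Real.log p / p) = Real.log p * (N / p) := by ring
      _ ≤ Real.log p * (((N / p : ℕ) : ℝ) + 1) := by gcongr
      _ = _ := by ring
  rw [sum_add_distrib] at h3
  have : N * ∑ p ∈ primesBetween 1 N, Real.log p / p ≤ N * (Real.log N + C) := by linarith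
  exact le_of_mul_le_mul_left this hN0

lemma primesBetween_succ (M N : ℕ) (h : M ≤ N) (f : ℕ → ℝ) :
    ∑ p ∈ primesBetween M (N + 1), f p =
      ∑ p ∈ primesBetween M N, f p + if (N + 1).Prime then f (N + 1) else 0 := by
  unfold primesBetween
  rw [sum_filter, sum_filter, ← Finset.insert_Ioc_right_eq_Ioc_add_one h, sum_insert (by simp), add_comm]

/-- Mertens' upper bound on a window. -/
lemma exists_sum_inv_primes_le :
    ∃ C : ℝ, 0 < C ∧ ∀ M N : ℕ, 2 ≤ M → M ≤ N →
      ∑ p ∈ primesBetween M N, 1 / (p : ℝ) ≤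
        Real.log (Real.log N) - Real.log (Real.log M) + C := by
  obtain ⟨C, hC, h⟩ := exists_sum_log_div_primes_le
  have hlog2 : 0 < Real.log 2 := Real.log_pos (by norm_num)
  refine ⟨1 + C / Real.log 2, by positivity, fun M N hM hMN => ?_⟩
  have hR : ∀ N : ℕ, M ≤ N → ∑ p ∈ primesBetween M N, Real.log p / p ≤ Real.log N + C := by
    intro N hN
    refine le_trans ?_ (h N (by omega))
    apply sum_le_sum_of_subset_of_nonneg
    · intro p hp
      rw [mem_primesBetween] at *
      exact ⟨⟨by omega, hp.1.2⟩, hp.2⟩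
    · intro p _ _
      have := Real.log_natCast_nonneg p
      positivity
  have hpos : ∀ n : ℕ, M ≤ n → 0 < Real.log n := fun n hn =>
    Real.log_pos (by exact_mod_cast (by omega : 1 < n))
  have claim : ∑ p ∈ primesBetween M N, 1 / (p : ℝ) ≤
      (∑ p ∈ primesBetween M N, Real.log p / p) / Real.log N
        + (Real.log (Real.log N) - Real.log (Real.log M)) + C * (1 / Real.log M - 1 / Real.log N) := by
    induction N, hMN using Nat.le_induction with
    | base => simp [primesBetween]
    | succ n hn ih =>
      rw [primesBetween_succ _ _ hn, primesBetween_succ _ _ hn]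
      set R := ∑ p ∈ primesBetween M n, Real.log p / p with hRdef
      have hRn := hR n hn
      have hl := hpos n hn
      have hl' := hpos (n + 1) (by omega)
      have hmono : Real.log n ≤ Real.log ((n + 1 : ℕ) : ℝ) :=
        Real.log_le_log (by exact_mod_cast (by omega : 0 < n)) (by exact_mod_cast (by omega))
      have h1 : (if (n + 1).Prime then (1 : ℝ) / ((n + 1 : ℕ) : ℝ) else 0) =
          (if (n + 1).Prime then Real.log ((n + 1 : ℕ) : ℝ) / ((n + 1 : ℕ) : ℝ) else 0)
            / Real.log ((n + 1 : ℕ) : ℝ) := by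
        split_ifs
        · field_simp
        · simp
      have h2 : 1 - Real.log n / Real.log ((n + 1 : ℕ) : ℝ) ≤
          Real.log (Real.log ((n + 1 : ℕ) : ℝ)) - Real.log (Real.log n) := by
        have := Real.one_sub_inv_le_log_of_pos (div_pos hl' hl)
        rwa [inv_div, Real.log_div hl'.ne' hl.ne'] at this
      have h3 : (R - C) * (1 / Real.log n - 1 / Real.log ((n + 1 : ℕ) : ℝ)) ≤
          1 - Real.log n / Real.log ((n + 1 : ℕ) : ℝ) := by
        have : 0 ≤ 1 / Real.log n - 1 / Real.log ((n + 1 : ℕ) : ℝ) :=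
          sub_nonneg.2 (one_div_le_one_div_of_le hl hmono)
        calc _ ≤ Real.log n * (1 / Real.log n - 1 / Real.log ((n + 1 : ℕ) : ℝ)) := by
              gcongr; linarith
          _ = _ := by field_simp
      rw [h1, add_div]
      have e1 : R / Real.log n = R * (1 / Real.log n) := by ring
      have e2 : R / Real.log ((n + 1 : ℕ) : ℝ) = R * (1 / Real.log ((n + 1 : ℕ) : ℝ)) := by ring
      rw [e1] at ih
      rw [e2]
      nlinarith
  have hl := hpos N hMN
  have hlM := hpos M le_rfl
  have h1 : (∑ p ∈ primesBetween M N, Real.log p / p) / Real.log N ≤ 1 + C / Real.log N := by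
    rw [div_le_iff₀ hl, add_mul, div_mul_cancel₀ _ hl.ne']
    linarith [hR N hMN]
  have h2 : C / Real.log M ≤ C / Real.log 2 := by
    gcongr; exact_mod_cast hM
  have e3 : C * (1 / Real.log M - 1 / Real.log N) = C / Real.log M - C / Real.log N := by ring
  linarith

lemma exists_sum_inv_primes_one_le :
    ∃ C : ℝ, 0 < C ∧ ∀ N : ℕ, 2 ≤ N →
      ∑ p ∈ primesBetween 1 N, 1 / (p : ℝ) ≤ Real.log (Real.log N) + C := by
  obtain ⟨C, hC, h⟩ := exists_sum_inv_primes_le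
  refine ⟨C + 1 + |Real.log (Real.log 2)|, by positivity, fun N hN => ?_⟩
  have h1 := h 2 N le_rfl hN
  have h2 : primesBetween 1 N = insert 2 (primesBetween 2 N) := by
    ext p
    simp only [mem_insert, mem_primesBetween]
    constructor
    · rintro ⟨⟨a, b⟩, c⟩
      by_cases hp : p = 2
      · exact Or.inl hp
      · exact Or.inr ⟨⟨by omega, b⟩, c⟩
    · rintro (rfl | ⟨⟨a, b⟩, c⟩)
      · exact ⟨⟨by norm_num, hN⟩, Nat.prime_two⟩
      · exact ⟨⟨by omega, b⟩, c⟩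
  rw [h2, sum_insert (by simp [mem_primesBetween])]
  have := neg_abs_le (Real.log (Real.log 2))
  push_cast at *
  linarith

lemma exists_sum_proper_inv_le :
    ∃ C : ℝ, 0 < C ∧ ∀ N : ℕ, ∑ q ∈ (ppowsUpTo N).filter (fun q => ¬ q.Prime),
      1 / (q : ℝ) ≤ C := by
  obtain ⟨C, hC, h⟩ := exists_sum_proper_log_div_le
  refine ⟨2 * C, by positivity, fun N => ?_⟩
  refine le_trans ?_ (mul_le_mul_of_nonneg_left (h N) zero_le_two)
  rw [mul_sum]
  refine sum_le_sum fun q hq => ?_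
  rw [mem_filter, mem_ppowsUpTo] at hq
  have hq2 : (2 : ℝ) ≤ q := by exact_mod_cast hq.1.1.1
  have : Real.log 2 ≤ Real.log q := Real.log_le_log (by norm_num) hq2
  have h2 := Real.log_two_gt_d9
  rw [← mul_div_assoc]
  gcongr
  linarith

lemma exists_sum_inv_ppowsUpTo_le :
    ∃ C : ℝ, 0 < C ∧ ∀ N : ℕ, 2 ≤ N →
      ∑ q ∈ ppowsUpTo N, 1 / (q : ℝ) ≤ Real.log (Real.log N) + C := by
  obtain ⟨C, hC, h⟩ := exists_sum_proper_inv_le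
  obtain ⟨C', hC', h'⟩ := exists_sum_inv_primes_one_le
  refine ⟨C + C', by positivity, fun N hN => ?_⟩
  rw [← sum_filter_add_sum_filter_not _ Nat.Prime, filter_prime_ppowsUpTo]
  linarith [h N, h' N hN]

/-- `q` divides `n` exactly (meant for prime powers `q`). -/
def ExactDvd (q n : ℕ) : Prop := q ∣ n ∧ ¬ q * q.minFac ∣ n

instance : DecidableRel ExactDvd := fun _ _ => inferInstanceAs (Decidable (_ ∧ _))

/-- The additive function with prescribed values on prime powers. -/
def primePowSum {M : Type*} [AddCommMonoid M] (φ : ℕ → M) (n : ℕ) : M :=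
  ∑ p ∈ n.primeFactors, φ (p ^ n.factorization p)

lemma exactDvd_prime_pow_iff {p k n : ℕ} (hp : p.Prime) (hk : k ≠ 0) (hn : n ≠ 0) :
    ExactDvd (p ^ k) n ↔ n.factorization p = k := by
  rw [ExactDvd, Nat.Prime.pow_minFac hp hk, ← pow_succ, hp.pow_dvd_iff_le_factorization hn,
    hp.pow_dvd_iff_le_factorization hn]
  omega

lemma sum_exactDvd_eq_primePowSum {M : Type*} [AddCommMonoid M] (φ : ℕ → M) {n N : ℕ}
    (hn : 1 ≤ n) (hnN : n ≤ N) :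
    ∑ q ∈ (ppowsUpTo N).filter (ExactDvd · n), φ q = primePowSum φ n := by
  have hn0 : n ≠ 0 := by omega
  refine sum_nbij' Nat.minFac (fun p => p ^ n.factorization p) ?_ ?_ ?_ ?_ ?_
  · intro q hq
    rw [mem_filter, mem_ppowsUpTo] at hq
    exact Nat.mem_primeFactors.2 ⟨Nat.minFac_prime (by omega),
      (Nat.minFac_dvd q).trans hq.2.1, hn0⟩
  · intro p hp
    have hpp := Nat.prime_of_mem_primeFactors hp
    have hk : n.factorization p ≠ 0 := by
      have := (hpp.dvd_iff_one_le_factorization hn0).1 (Nat.dvd_of_mem_primeFactors hp)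
      omega
    rw [mem_filter, mem_ppowsUpTo]
    have hle : p ^ n.factorization p ≤ n := Nat.le_of_dvd (by omega) (Nat.ordProj_dvd n p)
    refine ⟨⟨⟨?_, hle.trans hnN⟩, hpp.isPrimePow.pow hk⟩, ?_⟩
    · exact hpp.two_le.trans (Nat.le_self_pow hk p)
    · exact (exactDvd_prime_pow_iff hpp hk hn0).2 rfl
  · intro q hq
    rw [mem_filter, mem_ppowsUpTo] at hq
    obtain ⟨p, k, hp, hk, rfl⟩ := hq.1.2
    rw [Nat.Prime.pow_minFac hp.nat_prime hk.ne']
    rw [exactDvd_prime_pow_iff hp.nat_prime hk.ne' hn0] at hq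
    rw [hq.2]
  · intro p hp
    have hpp := Nat.prime_of_mem_primeFactors hp
    have hk : n.factorization p ≠ 0 := by
      have := (hpp.dvd_iff_one_le_factorization hn0).1 (Nat.dvd_of_mem_primeFactors hp)
      omega
    exact Nat.Prime.pow_minFac hpp hk
  · intro q hq
    rw [mem_filter, mem_ppowsUpTo] at hq
    obtain ⟨p, k, hp, hk, rfl⟩ := hq.1.2
    rw [exactDvd_prime_pow_iff hp.nat_prime hk.ne' hn0] at hq
    rw [Nat.Prime.pow_minFac hp.nat_prime hk.ne', hq.2]

lemma primePowSum_mul {M : Type*} [AddCommMonoid M] (φ : ℕ → M) {a b : ℕ} (hab : a.Coprime b) :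
    primePowSum φ (a * b) = primePowSum φ a + primePowSum φ b := by
  unfold primePowSum
  rw [hab.primeFactors_mul, sum_union hab.disjoint_primeFactors]
  congr 1
  · refine sum_congr rfl fun p hp => ?_
    rw [Nat.factorization_eq_of_coprime_left hab (by simpa using hp)]
  · refine sum_congr rfl fun p hp => ?_
    rw [Nat.factorization_eq_of_coprime_right hab (by simpa using hp)]

lemma primePowSum_prime_pow {M : Type*} [AddCommMonoid M] (φ : ℕ → M) {p k : ℕ} (hp : p.Prime)
    (hk : k ≠ 0) : primePowSum φ (p ^ k) = φ (p ^ k) := by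
  simp [primePowSum, Nat.primeFactors_prime_pow hk hp, hp.factorization_self]

lemma eq_primePowSum {M : Type*} [AddCommGroup M] {g : ℕ → M}
    (hg : ∀ m n : ℕ, m ≠ 0 → n ≠ 0 → Nat.Coprime m n → g (m * n) = g m + g n) {n : ℕ}
    (hn : n ≠ 0) : g n = primePowSum g n := by
  have h1 : g 1 = 0 := by
    have := hg 1 1 one_ne_zero one_ne_zero (by simp)
    simpa using this
  induction n using Nat.recOnPosPrimePosCoprime with
  | prime_pow p k hp hk => rw [primePowSum_prime_pow g hp hk.ne']
  | zero => exact absurd rfl hn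
  | one => simp [primePowSum, h1]
  | coprime a b ha hb hab iha ihb =>
    rw [primePowSum_mul g hab, hg a b (by omega) (by omega) hab, iha (by omega), ihb (by omega)]

lemma ExactDvd.coprime_div {q n : ℕ} (hq : IsPrimePow q) (h : ExactDvd q n) :
    q.Coprime (n / q) := by
  obtain ⟨p, k, hp, hk, rfl⟩ := hq
  have hp' := hp.nat_prime
  refine Nat.Coprime.pow_left _ ((Nat.Prime.coprime_iff_not_dvd hp').2 fun hd => h.2 ?_)
  rw [Nat.Prime.pow_minFac hp' hk.ne']
  calc p ^ k * p ∣ p ^ k * (n / p ^ k) := Nat.mul_dvd_mul_left _ hd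
    _ = n := Nat.mul_div_cancel' h.1

/-- The multiplicative function with logarithm prescribed on prime powers. -/
noncomputable def expSum (ψ : ℕ → ℝ) (n : ℕ) : ℝ := Real.exp (primePowSum ψ n)

lemma expSum_pos (ψ : ℕ → ℝ) (n : ℕ) : 0 < expSum ψ n := Real.exp_pos _

lemma expSum_prime_pow_le {ψ : ℕ → ℝ} (hψ : ∀ q, |ψ q| ≤ 1) {p : ℕ} (hp : p.Prime) (k : ℕ) :
    expSum ψ (p ^ k) ≤ Real.exp 1 := by
  refine Real.exp_le_exp.2 ?_
  by_cases hk : k = 0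
  · simp [hk, primePowSum]
  · rw [primePowSum_prime_pow _ hp hk]
    exact (le_abs_self _).trans (hψ _)

lemma expSum_mul (ψ : ℕ → ℝ) {a b : ℕ} (hab : a.Coprime b) :
    expSum ψ (a * b) = expSum ψ a * expSum ψ b := by
  rw [expSum, primePowSum_mul ψ hab, Real.exp_add]; rfl

lemma log_eq_primePowSum {n : ℕ} (hn : n ≠ 0) :
    Real.log n = primePowSum (fun q => Real.log q) n := by
  refine eq_primePowSum (g := fun q : ℕ => Real.log q) (fun m n hm hn _ => ?_) hn
  push_cast
  exact Real.log_mul (by exact_mod_cast hm) (by exact_mod_cast hn)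

lemma exists_log_mul_sum_expSum_le :
    ∃ C : ℝ, 0 < C ∧ ∀ (N : ℕ) (ψ : ℕ → ℝ), 1 ≤ N → (∀ q, |ψ q| ≤ 1) →
      Real.log N * ∑ n ∈ Icc 1 N, expSum ψ n ≤ C * N * ∑ n ∈ Icc 1 N, expSum ψ n / n := by
  obtain ⟨C, hC, h⟩ := exists_sum_log_ppowsUpTo_le
  refine ⟨Real.exp 1 * C + 1, by positivity, fun N ψ hN hψ => ?_⟩
  have hN0 : (0 : ℝ) < N := by exact_mod_cast hN
  have h1 : ∑ n ∈ Icc 1 N, expSum ψ n * Real.log n ≤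
      Real.exp 1 * C * N * ∑ n ∈ Icc 1 N, expSum ψ n / n := by
    have step : ∀ q ∈ ppowsUpTo N, ∑ n ∈ (Icc 1 N).filter (ExactDvd q ·), expSum ψ n * Real.log q
        ≤ ∑ m ∈ (Icc 1 N).filter (fun m => q * m ≤ N),
          Real.exp 1 * expSum ψ m * Real.log q := by
      intro q hq
      rw [mem_ppowsUpTo] at hq
      have hq0 : 0 < q := by omega
      have hl : 0 ≤ Real.log q := Real.log_natCast_nonneg q
      calc ∑ n ∈ (Icc 1 N).filter (ExactDvd q ·), expSum ψ n * Real.log q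
          ≤ ∑ n ∈ (Icc 1 N).filter (ExactDvd q ·),
              Real.exp 1 * expSum ψ (n / q) * Real.log q := by
            refine sum_le_sum fun n hn => ?_
            rw [mem_filter] at hn
            have hc := hn.2.coprime_div hq.2
            have e : expSum ψ n = expSum ψ q * expSum ψ (n / q) := by
              rw [← expSum_mul ψ hc, Nat.mul_div_cancel' hn.2.1]
            rw [e]
            have hle : expSum ψ q ≤ Real.exp 1 := by
              obtain ⟨p, k, hp, -, rfl⟩ := hq.2
              exact expSum_prime_pow_le hψ hp.nat_prime k
            have := expSum_pos ψ (n / q)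
            gcongr
        _ = ∑ m ∈ ((Icc 1 N).filter (ExactDvd q ·)).image (· / q),
              Real.exp 1 * expSum ψ m * Real.log q := by
            rw [sum_image]
            intro a ha b hb hab
            rw [mem_coe, mem_filter] at ha hb
            have : a / q = b / q := hab
            rw [← Nat.mul_div_cancel' ha.2.1, this, Nat.mul_div_cancel' hb.2.1]
        _ ≤ _ := by
            apply sum_le_sum_of_subset_of_nonneg
            · intro m hm
              obtain ⟨n, hn, rfl⟩ := mem_image.1 hm
              simp only [mem_filter, mem_Icc] at hn ⊢
              rw [Nat.mul_div_cancel' hn.2.1]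
              refine ⟨⟨?_, (Nat.div_le_self _ _).trans hn.1.2⟩, hn.1.2⟩
              exact Nat.div_pos (Nat.le_of_dvd (by omega) hn.2.1) hq0
            · intro m _ _
              have := expSum_pos ψ m
              positivity
    calc ∑ n ∈ Icc 1 N, expSum ψ n * Real.log n
        = ∑ n ∈ Icc 1 N, ∑ q ∈ ppowsUpTo N,
            if ExactDvd q n then expSum ψ n * Real.log q else 0 := by
          refine sum_congr rfl fun n hn => ?_
          rw [mem_Icc] at hn
          rw [log_eq_primePowSum (by omega), ← sum_exactDvd_eq_primePowSum _ hn.1 hn.2, mul_sum,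
            sum_filter]
      _ = ∑ q ∈ ppowsUpTo N, ∑ n ∈ (Icc 1 N).filter (ExactDvd q ·), expSum ψ n * Real.log q := by
          rw [sum_comm]
          exact sum_congr rfl fun q _ => by rw [sum_filter]
      _ ≤ ∑ q ∈ ppowsUpTo N, ∑ m ∈ (Icc 1 N).filter (fun m => q * m ≤ N),
          Real.exp 1 * expSum ψ m * Real.log q := sum_le_sum step
      _ = ∑ m ∈ Icc 1 N, Real.exp 1 * expSum ψ m * ∑ q ∈ ppowsUpTo (N / m), Real.log q := by
          simp_rw [sum_filter]
          rw [sum_comm]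
          refine sum_congr rfl fun m hm => ?_
          rw [mem_Icc] at hm
          rw [mul_sum, ← sum_filter]
          refine sum_congr ?_ fun _ _ => rfl
          ext q
          simp only [mem_filter, mem_ppowsUpTo, Nat.le_div_iff_mul_le (show 0 < m by omega)]
          constructor
          · rintro ⟨⟨⟨a, b⟩, c⟩, d⟩
            exact ⟨⟨a, d⟩, c⟩
          · rintro ⟨⟨a, d⟩, c⟩
            exact ⟨⟨⟨a, (Nat.le_mul_of_pos_right q (by omega)).trans d⟩, c⟩, d⟩
      _ ≤ ∑ m ∈ Icc 1 N, Real.exp 1 * expSum ψ m * (C * (N / m)) := by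
          refine sum_le_sum fun m hm => ?_
          have := expSum_pos ψ m
          have h2 := h (N / m)
          have h3 : ((N / m : ℕ) : ℝ) ≤ N / m := Nat.cast_div_le
          gcongr
          exact h2.trans (by gcongr)
      _ = _ := by
          rw [mul_sum]
          exact sum_congr rfl fun m _ => by ring
  have h2 : ∑ n ∈ Icc 1 N, expSum ψ n * Real.log (N / n) ≤ N * ∑ n ∈ Icc 1 N, expSum ψ n / n := by
    rw [mul_sum]
    refine sum_le_sum fun n hn => ?_
    rw [mem_Icc] at hn
    have hn0 : (0 : ℝ) < n := by exact_mod_cast hn.1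
    have h3 : Real.log (N / n) ≤ N / n :=
      (Real.log_le_sub_one_of_pos (by positivity)).trans (by linarith)
    have := expSum_pos ψ n
    calc _ ≤ expSum ψ n * (N / n) := by gcongr
      _ = _ := by ring
  have h3 : Real.log N * ∑ n ∈ Icc 1 N, expSum ψ n =
      ∑ n ∈ Icc 1 N, expSum ψ n * Real.log n + ∑ n ∈ Icc 1 N, expSum ψ n * Real.log (N / n) := by
    rw [← sum_add_distrib, mul_sum]
    refine sum_congr rfl fun n hn => ?_
    rw [mem_Icc] at hn
    have hn0 : (n : ℝ) ≠ 0 := by exact_mod_cast (by omega : n ≠ 0)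
    rw [Real.log_div hN0.ne' hn0]
    ring
  rw [h3]
  linarith

lemma exists_sum_expSum_div_le :
    ∃ C : ℝ, 0 < C ∧ ∀ (N : ℕ) (ψ : ℕ → ℝ), (∀ q, |ψ q| ≤ 1) →
      ∑ n ∈ Icc 1 N, expSum ψ n / n ≤
        Real.exp (∑ p ∈ primesBetween 1 N, Real.exp (ψ p) / p + C) := by
  have hs : Summable (fun n : ℕ => 1 / (n : ℝ) ^ 2) := Real.summable_one_div_nat_pow.2 (by norm_num)
  refine ⟨2 * Real.exp 1 * (∑' n : ℕ, 1 / (n : ℝ) ^ 2) + 1, by positivity, fun N ψ hψ => ?_⟩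
  set f : ℕ → ℝ := fun n => expSum ψ n / n with hf
  have hf1 : f 1 = 1 := by simp [hf, expSum, primePowSum]
  have hf0 : ∀ n, 0 ≤ f n := fun n => div_nonneg (expSum_pos ψ n).le (Nat.cast_nonneg n)
  have hmul : ∀ {m n : ℕ}, m.Coprime n → f (m * n) = f m * f n := by
    intro m n hmn
    simp only [hf]
    rw [expSum_mul ψ hmn]
    push_cast
    rw [mul_div_mul_comm]
  have hgeo : ∀ {p : ℕ}, p.Prime → ∀ k : ℕ, f (p ^ k) ≤ Real.exp 1 * (1 / (p : ℝ)) ^ k := by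
    intro p hp k
    have hp0 : (0 : ℝ) < p := by exact_mod_cast hp.pos
    simp only [hf]
    push_cast
    rw [one_div, inv_pow, ← div_eq_mul_inv]
    gcongr
    exact expSum_prime_pow_le hψ hp k
  have hr : ∀ {p : ℕ}, p.Prime → (1 / (p : ℝ)) ≤ 1 / 2 := by
    intro p hp
    exact one_div_le_one_div_of_le two_pos (by exact_mod_cast hp.two_le)
  have hsumgeo : ∀ {p : ℕ}, p.Prime → Summable (fun k : ℕ => Real.exp 1 * (1 / (p : ℝ)) ^ k) := by
    intro p hp
    exact (summable_geometric_of_lt_one (by positivity)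
      ((hr hp).trans_lt (by norm_num))).mul_left _
  have hsum : ∀ {p : ℕ}, p.Prime → Summable (fun k : ℕ => ‖f (p ^ k)‖) := by
    intro p hp
    refine Summable.of_nonneg_of_le (fun _ => norm_nonneg _) (fun k => ?_) (hsumgeo hp)
    rw [Real.norm_of_nonneg (hf0 _)]
    exact hgeo hp k
  have hE := EulerProduct.summable_and_hasSum_smoothNumbers_prod_primesBelow_tsum hf1 hmul hsum (N + 1)
  have hfac : ∀ p ∈ (N + 1).primesBelow, ∑' k : ℕ, f (p ^ k) ≤
      Real.exp (Real.exp (ψ p) / p + 2 * Real.exp 1 * (1 / (p : ℝ) ^ 2)) := by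
    intro p hp
    have hpp := Nat.prime_of_mem_primesBelow hp
    have hp0 : (0 : ℝ) < p := by exact_mod_cast hpp.pos
    have hs' : Summable (fun k : ℕ => f (p ^ k)) := (hsum hpp).of_norm
    rw [← hs'.sum_add_tsum_nat_add 2]
    have e1 : f (p ^ 0) = 1 := by simpa using hf1
    have e2 : f (p ^ 1) = Real.exp (ψ p) / p := by
      simp only [hf, expSum]
      rw [primePowSum_prime_pow _ hpp one_ne_zero, pow_one]
    have e3 : ∑' k : ℕ, f (p ^ (k + 2)) ≤ 2 * Real.exp 1 * (1 / (p : ℝ) ^ 2) := by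
      have hg := hasSum_geometric_of_lt_one (r := 1 / (p : ℝ)) (by positivity)
        ((hr hpp).trans_lt (by norm_num))
      have hg2 := hg.mul_left (Real.exp 1 * (1 / (p : ℝ)) ^ 2)
      calc _ ≤ ∑' k : ℕ, Real.exp 1 * (1 / (p : ℝ)) ^ 2 * (1 / (p : ℝ)) ^ k := by
            refine Summable.tsum_le_tsum (fun k => ?_) ((summable_nat_add_iff 2).2 hs') hg2.summable
            refine (hgeo hpp (k + 2)).trans (le_of_eq ?_)
            ring
        _ = Real.exp 1 * (1 / (p : ℝ)) ^ 2 * (1 - 1 / (p : ℝ))⁻¹ := hg2.tsum_eq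
        _ ≤ Real.exp 1 * (1 / (p : ℝ)) ^ 2 * 2 := by
            gcongr
            rw [inv_le_comm₀ (by linarith [hr hpp]) two_pos]
            linarith [hr hpp]
        _ = _ := by ring
    rw [sum_range_succ, sum_range_one, e1, e2]
    have := Real.add_one_le_exp (Real.exp (ψ p) / p + 2 * Real.exp 1 * (1 / (p : ℝ) ^ 2))
    linarith
  have hpb : (N + 1).primesBelow = primesBetween 1 N := by
    ext p
    rw [Nat.mem_primesBelow, mem_primesBetween]
    constructor
    · rintro ⟨a, b⟩
      exact ⟨⟨b.one_lt, by omega⟩, b⟩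
    · rintro ⟨⟨a, b⟩, c⟩
      exact ⟨by omega, c⟩
  calc ∑ n ∈ Icc 1 N, f n ≤ ∑' m : (N + 1).smoothNumbers, f m := by
        have hsub : ∀ n ∈ Icc 1 N, n ∈ (N + 1).smoothNumbers := by
          intro n hn
          rw [mem_Icc] at hn
          exact Nat.mem_smoothNumbers_of_lt (by omega) (by omega)
        rw [← sum_attach]
        have hinj : Set.InjOn (fun n : {x // x ∈ Icc 1 N} =>
            (⟨n.1, hsub n.1 n.2⟩ : (N + 1).smoothNumbers)) ((Icc 1 N).attach : Finset _) := by
          intro a _ b _ hab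
          exact Subtype.ext (congrArg (fun m : (N + 1).smoothNumbers => (m : ℕ)) hab)
        calc ∑ x ∈ (Icc 1 N).attach, f x.1 = ∑ m ∈ (Icc 1 N).attach.image (fun n =>
            (⟨n.1, hsub n.1 n.2⟩ : (N + 1).smoothNumbers)), f m := by
              rw [sum_image hinj]
          _ ≤ _ := hE.2.summable.sum_le_tsum _ (fun _ _ => hf0 _)
    _ = ∏ p ∈ (N + 1).primesBelow, ∑' k : ℕ, f (p ^ k) := hE.2.tsum_eq
    _ ≤ ∏ p ∈ (N + 1).primesBelow,
        Real.exp (Real.exp (ψ p) / p + 2 * Real.exp 1 * (1 / (p : ℝ) ^ 2)) :=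
        prod_le_prod (fun p _ => tsum_nonneg fun _ => hf0 _) hfac
    _ = Real.exp (∑ p ∈ primesBetween 1 N, Real.exp (ψ p) / p +
        2 * Real.exp 1 * ∑ p ∈ primesBetween 1 N, 1 / (p : ℝ) ^ 2) := by
        rw [← Real.exp_sum, hpb, sum_add_distrib, mul_sum]
    _ ≤ _ := by
        gcongr
        have := hs.sum_le_tsum (primesBetween 1 N) (fun _ _ => by positivity)
        have : 2 * Real.exp 1 * ∑ p ∈ primesBetween 1 N, 1 / (p : ℝ) ^ 2 ≤
          2 * Real.exp 1 * ∑' n : ℕ, 1 / (n : ℝ) ^ 2 := by gcongr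
        linarith

/-- The density of the integers exactly divisible by the prime power `q`. -/
noncomputable def exactDensity (q : ℕ) : ℝ := 1 / q * (1 - 1 / q.minFac)

lemma exactDensity_nonneg (q : ℕ) : 0 ≤ exactDensity q := by
  have : (1 : ℝ) / q.minFac ≤ 1 := by
    rw [div_le_one (by exact_mod_cast Nat.minFac_pos q)]
    exact_mod_cast Nat.minFac_pos q
  exact mul_nonneg (by positivity) (by linarith)

lemma exactDensity_le (q : ℕ) : exactDensity q ≤ 1 / q := by
  have : (0 : ℝ) ≤ 1 / q.minFac := by positivity
  exact mul_le_of_le_one_right (by positivity) (by linarith)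

lemma half_inv_le_exactDensity {q : ℕ} (hq : 2 ≤ q) : 1 / q ≤ 2 * exactDensity q := by
  have h2 : (2 : ℝ) ≤ q.minFac := by exact_mod_cast (Nat.minFac_prime (by omega)).two_le
  have : (1 : ℝ) / q.minFac ≤ 1 / 2 := one_div_le_one_div_of_le two_pos h2
  have h3 : (0 : ℝ) ≤ 1 / q := by positivity
  unfold exactDensity
  nlinarith

lemma exists_abs_sum_primes_sub_mean_le :
    ∃ C : ℝ, 0 < C ∧ ∀ (N : ℕ) (ε : ℕ → ℝ), (∀ q, |ε q| ≤ 1) →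
      |∑ p ∈ primesBetween 1 N, ε p / p - ∑ q ∈ ppowsUpTo N, ε q * exactDensity q| ≤ C := by
  have hs : Summable (fun n : ℕ => 1 / (n : ℝ) ^ 2) := Real.summable_one_div_nat_pow.2 (by norm_num)
  obtain ⟨C, hC, h⟩ := exists_sum_proper_inv_le
  refine ⟨(∑' n : ℕ, 1 / (n : ℝ) ^ 2) + C, by positivity, fun N ε hε => ?_⟩
  rw [← sum_filter_add_sum_filter_not (ppowsUpTo N) Nat.Prime, filter_prime_ppowsUpTo,
    ← sub_sub, ← sum_sub_distrib]
  refine (abs_sub _ _).trans (add_le_add ?_ ?_)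
  · refine (abs_sum_le_sum_abs _ _).trans (le_trans (sum_le_sum fun p hp => ?_)
      (hs.sum_le_tsum (primesBetween 1 N) (fun _ _ => by positivity)))
    rw [mem_primesBetween] at hp
    have hp0 : (0 : ℝ) < p := by exact_mod_cast hp.2.pos
    have : ε p / p - ε p * exactDensity p = ε p * (1 / (p : ℝ) ^ 2) := by
      rw [exactDensity, hp.2.minFac_eq]
      field_simp
      ring
    rw [this, abs_mul, abs_of_pos (show (0 : ℝ) < 1 / (p : ℝ) ^ 2 by positivity)]
    exact mul_le_of_le_one_left (by positivity) (hε p)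
  · refine (abs_sum_le_sum_abs _ _).trans (le_trans (sum_le_sum fun q _ => ?_) (h N))
    rw [abs_mul, abs_of_nonneg (exactDensity_nonneg q)]
    exact (mul_le_of_le_one_left (exactDensity_nonneg q) (hε q)).trans (exactDensity_le q)

lemma primePowSum_const_mul (c : ℝ) (ε : ℕ → ℝ) (n : ℕ) :
    primePowSum (fun q => c * ε q) n = c * primePowSum ε n := by
  simp [primePowSum, mul_sum]

/-- Exponential moments of an additive function supported on prime powers above `M`. -/
lemma exists_sum_exp_centered_le :
    ∃ C : ℝ, 0 < C ∧ ∀ (M N : ℕ) (ε : ℕ → ℝ) (c : ℝ), 2 ≤ M → M ≤ N → (∀ q, |ε q| ≤ 1) →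
      (∀ q, q ≤ M → ε q = 0) → |c| ≤ 1 →
      ∑ n ∈ Icc 1 N,
          Real.exp (c * (primePowSum ε n - ∑ q ∈ ppowsUpTo N, ε q * exactDensity q)) ≤
        C * N * Real.exp (c ^ 2 * (Real.log (Real.log N) - Real.log (Real.log M))) := by
  obtain ⟨C₁, hC₁, h₁⟩ := exists_log_mul_sum_expSum_le
  obtain ⟨C₂, hC₂, h₂⟩ := exists_sum_expSum_div_le
  obtain ⟨C₃, hC₃, h₃⟩ := exists_sum_inv_primes_one_le
  obtain ⟨C₄, hC₄, h₄⟩ := exists_sum_inv_primes_le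
  obtain ⟨C₅, hC₅, h₅⟩ := exists_abs_sum_primes_sub_mean_le
  refine ⟨C₁ * Real.exp (C₂ + C₃ + C₄ + C₅), by positivity, fun M N ε c hM hMN hε hsupp hc => ?_⟩
  set W := Real.log (Real.log N) - Real.log (Real.log M) with hW
  set A := ∑ q ∈ ppowsUpTo N, ε q * exactDensity q with hA
  have hlog : 0 < Real.log N := Real.log_pos (by exact_mod_cast (by omega : 1 < N))
  have hψ : ∀ q, |c * ε q| ≤ 1 := fun q => by
    rw [abs_mul]
    exact mul_le_one₀ hc (abs_nonneg _) (hε q)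
  have hc2 : c ^ 2 ≤ 1 := by rw [← sq_abs]; exact pow_le_one₀ (abs_nonneg _) hc
  have hsq : ∑ p ∈ primesBetween 1 N, (c * ε p) ^ 2 / p ≤ c ^ 2 * (W + C₄) := by
    refine le_trans ?_ (mul_le_mul_of_nonneg_left (h₄ M N hM hMN) (sq_nonneg c))
    rw [mul_sum]
    have hsub : primesBetween M N ⊆ primesBetween 1 N := by
      intro p hp
      rw [mem_primesBetween] at *
      exact ⟨⟨by omega, hp.1.2⟩, hp.2⟩
    rw [← sum_subset hsub]
    · refine sum_le_sum fun p _ => ?_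
      rw [mul_pow, mul_div_assoc]
      gcongr
      rw [← sq_abs]
      exact pow_le_one₀ (abs_nonneg _) (hε p)
    · intro p hp hp'
      rw [mem_primesBetween] at hp hp'
      rw [hsupp p (by by_contra hlt; exact hp' ⟨⟨by omega, hp.1.2⟩, hp.2⟩)]
      simp
  have hexp : ∑ p ∈ primesBetween 1 N, Real.exp (c * ε p) / p ≤
      Real.log (Real.log N) + C₃ + c * ∑ p ∈ primesBetween 1 N, ε p / p + c ^ 2 * (W + C₄) := by
    calc _ ≤ ∑ p ∈ primesBetween 1 N, (1 / (p : ℝ) + c * (ε p / p) + (c * ε p) ^ 2 / p) := by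
          refine sum_le_sum fun p _ => ?_
          have := (abs_le.1 (Real.abs_exp_sub_one_sub_id_le (hψ p))).2
          calc Real.exp (c * ε p) / p ≤ (1 + c * ε p + (c * ε p) ^ 2) / p := by
                gcongr; linarith
            _ = _ := by ring
      _ ≤ _ := by
          rw [sum_add_distrib, sum_add_distrib, ← mul_sum]
          linarith [h₃ N (by omega)]
  have hmean : c * ∑ p ∈ primesBetween 1 N, ε p / p ≤ c * A + C₅ := by
    have := abs_le.1 (h₅ N ε hε)
    have h6 : |c * (∑ p ∈ primesBetween 1 N, ε p / p - A)| ≤ C₅ := by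
      rw [abs_mul]
      calc _ ≤ 1 * C₅ := mul_le_mul hc (h₅ N ε hε) (abs_nonneg _) zero_le_one
        _ = _ := one_mul _
    have := (abs_le.1 h6).2
    linarith
  have hmain : Real.log N * ∑ n ∈ Icc 1 N, expSum (fun q => c * ε q) n ≤
      Real.log N * (C₁ * Real.exp (C₂ + C₃ + C₄ + C₅) * N * Real.exp (c ^ 2 * W) *
        Real.exp (c * A)) := by
    calc _ ≤ C₁ * N * ∑ n ∈ Icc 1 N, expSum (fun q => c * ε q) n / n :=
          h₁ N _ (by omega) hψ
      _ ≤ C₁ * N * Real.exp (∑ p ∈ primesBetween 1 N, Real.exp (c * ε p) / p + C₂) := by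
          gcongr
          exact h₂ N _ hψ
      _ ≤ C₁ * N * Real.exp (Real.log (Real.log N) + (C₂ + C₃ + C₄ + C₅) + c ^ 2 * W + c * A) := by
          refine mul_le_mul_of_nonneg_left (Real.exp_le_exp.2 ?_) (by positivity)
          have : c ^ 2 * C₄ ≤ C₄ := mul_le_of_le_one_left hC₄.le hc2
          linarith
      _ = _ := by
          rw [Real.exp_add, Real.exp_add, Real.exp_add, Real.exp_log hlog]
          ring
  have hfin := le_of_mul_le_mul_left hmain hlog
  have e : ∀ n, Real.exp (c * (primePowSum ε n - A)) =
      expSum (fun q => c * ε q) n * Real.exp (-(c * A)) := by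
    intro n
    rw [expSum, primePowSum_const_mul, ← Real.exp_add]
    ring_nf
  simp_rw [e]
  rw [← sum_mul]
  calc _ ≤ (C₁ * Real.exp (C₂ + C₃ + C₄ + C₅) * N * Real.exp (c ^ 2 * W) *
        Real.exp (c * A)) * Real.exp (-(c * A)) := by gcongr
    _ = _ := by
        rw [mul_assoc _ (Real.exp (c * A)), ← Real.exp_add]
        simp

lemma exists_abs_rpow_le_exp_add_exp_neg (β : ℝ) (hβ : 0 ≤ β) :
    ∃ K : ℝ, 0 < K ∧ ∀ y : ℝ, |y| ^ β ≤ K * (Real.exp y + Real.exp (-y)) := by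
  refine ⟨(⌈β⌉₊).factorial * Real.exp 1, by positivity, fun y => ?_⟩
  have h0 := abs_nonneg y
  have h1 : |y| ^ β ≤ (1 + |y|) ^ ⌈β⌉₊ := by
    calc |y| ^ β ≤ (1 + |y|) ^ β := by gcongr; linarith
      _ ≤ (1 + |y|) ^ ((⌈β⌉₊ : ℕ) : ℝ) :=
        Real.rpow_le_rpow_of_exponent_le (by linarith) (Nat.le_ceil β)
      _ = _ := Real.rpow_natCast _ _
  have h2 := Real.pow_div_factorial_le_exp (1 + |y|) (by positivity) ⌈β⌉₊
  rw [div_le_iff₀ (by positivity), Real.exp_add] at h2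
  have h3 : Real.exp |y| ≤ Real.exp y + Real.exp (-y) := by
    rcases abs_cases y with h | h <;> rw [h.1] <;> linarith [Real.exp_pos y, Real.exp_pos (-y)]
  calc _ ≤ _ := h1.trans h2
    _ = ((⌈β⌉₊).factorial * Real.exp 1) * Real.exp |y| := by ring
    _ ≤ _ := by gcongr

/-- A Turán–Kubilius inequality for all moments. -/
lemma exists_moment_centered_le (β : ℝ) (hβ : 0 ≤ β) :
    ∃ C : ℝ, 0 < C ∧ ∀ (M N : ℕ) (ε : ℕ → ℝ) (L : ℝ), 2 ≤ M → M ≤ N → (∀ q, |ε q| ≤ 1) →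
      (∀ q, q ≤ M → ε q = 0) → 1 ≤ L → Real.log (Real.log N) - Real.log (Real.log M) ≤ L →
      ∑ n ∈ Icc 1 N, |primePowSum ε n - ∑ q ∈ ppowsUpTo N, ε q * exactDensity q| ^ β ≤
        C * N * (L ^ ((1 : ℝ) / 2)) ^ β := by
  obtain ⟨C, hC, h⟩ := exists_sum_exp_centered_le
  obtain ⟨K, hK, hKy⟩ := exists_abs_rpow_le_exp_add_exp_neg β hβ
  refine ⟨2 * K * C * Real.exp 1, by positivity, fun M N ε L hM hMN hε hsupp hL hLW => ?_⟩
  set A := ∑ q ∈ ppowsUpTo N, ε q * exactDensity q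
  rw [← Real.sqrt_eq_rpow]
  set s := Real.sqrt L with hs
  have hs1 : 1 ≤ s := Real.one_le_sqrt.2 hL
  have hs0 : 0 < s := by linarith
  have hss : s ^ 2 = L := Real.sq_sqrt (by linarith)
  have hinv : |1 / s| ≤ 1 := by
    rw [abs_of_pos (by positivity), div_le_one hs0]; exact hs1
  have hbound : ∀ c : ℝ, |c| ≤ 1 → c ^ 2 = 1 / L →
      ∑ n ∈ Icc 1 N, Real.exp (c * (primePowSum ε n - A)) ≤ C * N * Real.exp 1 := by
    intro c hc hc2
    refine (h M N ε c hM hMN hε hsupp hc).trans ?_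
    gcongr
    rw [hc2, one_div, inv_mul_le_iff₀ (by linarith)]
    linarith
  have h1 := hbound (1 / s) hinv (by rw [div_pow, hss, one_pow])
  have h2 := hbound (-(1 / s)) (by rwa [abs_neg]) (by rw [neg_sq, div_pow, hss, one_pow])
  calc _ ≤ ∑ n ∈ Icc 1 N, s ^ β * (K * (Real.exp (1 / s * (primePowSum ε n - A)) +
        Real.exp (-(1 / s) * (primePowSum ε n - A)))) := by
        refine sum_le_sum fun n _ => ?_
        have e : |primePowSum ε n - A| = s * |1 / s * (primePowSum ε n - A)| := by
          rw [abs_mul, abs_of_pos (show 0 < 1 / s by positivity)]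
          field_simp
        rw [e, Real.mul_rpow hs0.le (abs_nonneg _), neg_mul]
        gcongr
        exact hKy _
    _ = s ^ β * (K * (∑ n ∈ Icc 1 N, Real.exp (1 / s * (primePowSum ε n - A)) +
        ∑ n ∈ Icc 1 N, Real.exp (-(1 / s) * (primePowSum ε n - A)))) := by
        rw [← mul_sum, ← mul_sum, sum_add_distrib]
    _ ≤ s ^ β * (K * (C * N * Real.exp 1 + C * N * Real.exp 1)) := by gcongr
    _ = _ := by ring

/-- Prime powers in `(M, N]`. -/
noncomputable def ppowsBetween (M N : ℕ) : Finset ℕ := (ppowsUpTo N).filter (M < ·)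

lemma exists_real_dual_le {α β : ℝ} (hαβ : α.HolderConjugate β) :
    ∃ C : ℝ, 0 < C ∧ ∀ (M N : ℕ) (h : ℕ → ℝ) (L : ℝ), 2 ≤ M → M ≤ N →
      1 ≤ L → Real.log (Real.log N) - Real.log (Real.log M) ≤ L →
      ∑ q ∈ ppowsBetween M N,
        |∑ n ∈ (Icc 1 N).filter (ExactDvd q ·), h n - exactDensity q * ∑ n ∈ Icc 1 N, h n| ≤
        C * L ^ ((1 : ℝ) / 2) * (N : ℝ) ^ (1 / β) *
          (∑ n ∈ Icc 1 N, |h n| ^ α) ^ (1 / α) := by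
  have hβ := hαβ.symm.pos
  obtain ⟨C, hC, hmom⟩ := exists_moment_centered_le β hβ.le
  refine ⟨C ^ (1 / β), by positivity, fun M N h L hM hMN hL hLW => ?_⟩
  set D : ℕ → ℝ := fun q =>
    ∑ n ∈ (Icc 1 N).filter (ExactDvd q ·), h n - exactDensity q * ∑ n ∈ Icc 1 N, h n with hD
  set ε : ℕ → ℝ := fun q => if M < q then (if 0 ≤ D q then 1 else -1) else 0 with hε
  have hε1 : ∀ q, |ε q| ≤ 1 := by
    intro q
    simp only [hε]
    split_ifs <;> simp
  have hε0 : ∀ q, q ≤ M → ε q = 0 := fun q hq => by simp [hε, not_lt.2 hq]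
  have e1 : ∑ q ∈ ppowsBetween M N, |D q| = ∑ q ∈ ppowsUpTo N, ε q * D q := by
    rw [ppowsBetween, sum_filter]
    refine sum_congr rfl fun q _ => ?_
    simp only [hε]
    split_ifs with h1 h2
    · rw [one_mul, abs_of_nonneg h2]
    · rw [neg_one_mul, abs_of_neg (not_le.1 h2)]
    · simp
  have e2 : ∑ q ∈ ppowsUpTo N, ε q * D q =
      ∑ n ∈ Icc 1 N, h n * (primePowSum ε n - ∑ q ∈ ppowsUpTo N, ε q * exactDensity q) := by
    have e3 : ∀ n ∈ Icc 1 N, h n * primePowSum ε n =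
        ∑ q ∈ ppowsUpTo N, if ExactDvd q n then h n * ε q else 0 := by
      intro n hn
      rw [mem_Icc] at hn
      rw [← sum_exactDvd_eq_primePowSum ε hn.1 hn.2, mul_sum, sum_filter]
    simp_rw [mul_sub]
    rw [sum_sub_distrib, sum_congr rfl e3, sum_comm, ← sum_mul, mul_sum, ← sum_sub_distrib]
    refine sum_congr rfl fun q _ => ?_
    rw [hD]
    simp only
    rw [mul_sub, ← sum_filter, mul_sum]
    congr 1
    · exact sum_congr rfl fun n _ => mul_comm _ _
    · ring
  calc ∑ q ∈ ppowsBetween M N, |D q| = _ := e1.trans e2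
    _ ≤ _ := Real.inner_le_Lp_mul_Lq _ _ _ hαβ
    _ ≤ (∑ n ∈ Icc 1 N, |h n| ^ α) ^ (1 / α) * (C * N * (L ^ ((1 : ℝ) / 2)) ^ β) ^ (1 / β) := by
        have hs : 0 ≤ ∑ n ∈ Icc 1 N, |h n| ^ α := sum_nonneg fun _ _ => by positivity
        have hs' : 0 ≤ ∑ n ∈ Icc 1 N,
            |primePowSum ε n - ∑ q ∈ ppowsUpTo N, ε q * exactDensity q| ^ β :=
          sum_nonneg fun _ _ => by positivity
        have := hmom M N ε L hM hMN hε1 hε0 hL hLW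
        gcongr
    _ = _ := by
        rw [Real.mul_rpow (by positivity) (by positivity), Real.mul_rpow hC.le (by positivity),
          ← Real.rpow_mul (by positivity) β, mul_one_div_cancel hβ.ne', Real.rpow_one]
        ring

/-- The dual Turán–Kubilius inequality in `ℓ¹` form. -/
lemma exists_dual_le {α β : ℝ} (hαβ : α.HolderConjugate β) :
    ∃ C : ℝ, 0 < C ∧ ∀ (M N : ℕ) (h : ℕ → ℂ) (L : ℝ), 2 ≤ M → M ≤ N →
      1 ≤ L → Real.log (Real.log N) - Real.log (Real.log M) ≤ L →
      ∑ q ∈ ppowsBetween M N,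
        ‖∑ n ∈ (Icc 1 N).filter (ExactDvd q ·), h n - exactDensity q * ∑ n ∈ Icc 1 N, h n‖ ≤
        C * L ^ ((1 : ℝ) / 2) * (N : ℝ) ^ (1 / β) *
          (∑ n ∈ Icc 1 N, ‖h n‖ ^ α) ^ (1 / α) := by
  obtain ⟨C, hC, hreal⟩ := exists_real_dual_le hαβ
  have hα := hαβ.pos
  refine ⟨2 * C, by positivity, fun M N h L hM hMN hL hLW => ?_⟩
  have hone : ∀ k : ℕ → ℝ, (∀ n, |k n| ≤ ‖h n‖) →
      ∑ q ∈ ppowsBetween M N,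
        |∑ n ∈ (Icc 1 N).filter (ExactDvd q ·), k n - exactDensity q * ∑ n ∈ Icc 1 N, k n| ≤
        C * L ^ ((1 : ℝ) / 2) * (N : ℝ) ^ (1 / β) * (∑ n ∈ Icc 1 N, ‖h n‖ ^ α) ^ (1 / α) := by
    intro k hk
    refine (hreal M N k L hM hMN hL hLW).trans ?_
    have : 0 ≤ ∑ n ∈ Icc 1 N, |k n| ^ α := sum_nonneg fun _ _ => by positivity
    gcongr with n _
    exact hk n
  have h1 := hone (fun n => (h n).re) (fun n => Complex.abs_re_le_norm _)
  have h2 := hone (fun n => (h n).im) (fun n => Complex.abs_im_le_norm _)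
  calc _ ≤ ∑ q ∈ ppowsBetween M N,
        (|∑ n ∈ (Icc 1 N).filter (ExactDvd q ·), (h n).re -
            exactDensity q * ∑ n ∈ Icc 1 N, (h n).re| +
          |∑ n ∈ (Icc 1 N).filter (ExactDvd q ·), (h n).im -
            exactDensity q * ∑ n ∈ Icc 1 N, (h n).im|) := by
        refine sum_le_sum fun q _ => (Complex.norm_le_abs_re_add_abs_im _).trans (le_of_eq ?_)
        rw [Complex.sub_re, Complex.sub_im, Complex.re_ofReal_mul, Complex.im_ofReal_mul,
          Complex.re_sum, Complex.re_sum, Complex.im_sum, Complex.im_sum]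
    _ ≤ _ := by
        rw [sum_add_distrib]
        linarith

lemma abs_sum_dvd_sub_le {X : ℝ} (hX : 0 ≤ X) (d : ℕ) :
    |∑ n ∈ Icc 1 ⌊X⌋₊, (if d ∣ n then (1 : ℝ) else 0) - X / d| ≤ 1 := by
  have e : ∑ n ∈ Icc 1 ⌊X⌋₊, (if d ∣ n then (1 : ℝ) else 0) = (⌊X / d⌋₊ : ℝ) := by
    rw [sum_boole, Nat.floor_div_natCast, ← Nat.Ioc_filter_dvd_card_eq_div]
    rfl
  rw [e]
  have h1 := Nat.floor_le (show 0 ≤ X / d by positivity)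
  have h2 := Nat.lt_floor_add_one (X / d)
  rw [abs_le]
  constructor <;> linarith

lemma exactDvd_ite (q n : ℕ) : (if ExactDvd q n then (1 : ℝ) else 0) =
    (if q ∣ n then 1 else 0) - (if q * q.minFac ∣ n then 1 else 0) := by
  by_cases h1 : q ∣ n <;> by_cases h2 : q * q.minFac ∣ n
  · simp [ExactDvd, h1, h2]
  · simp [ExactDvd, h1, h2]
  · exact absurd ((Dvd.intro _ rfl).trans h2) h1
  · simp [ExactDvd, h1, h2]

lemma abs_sum_exactDvd_sub_le {X : ℝ} (hX : 0 ≤ X) (q : ℕ) :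
    |∑ n ∈ Icc 1 ⌊X⌋₊, (if ExactDvd q n then (1 : ℝ) else 0) - X * exactDensity q| ≤ 2 := by
  simp_rw [exactDvd_ite]
  rw [sum_sub_distrib]
  have h1 := abs_le.1 (abs_sum_dvd_sub_le hX q)
  have h2 := abs_le.1 (abs_sum_dvd_sub_le hX (q * q.minFac))
  have e : X * exactDensity q = X / q - X / ((q * q.minFac : ℕ) : ℝ) := by
    rw [exactDensity]
    push_cast
    rw [mul_sub, mul_one, mul_sub, one_div_mul_one_div]
    ring
  rw [e, abs_le]
  constructor <;> linarith

lemma coprime_mul_minFac {q r : ℕ} (h : q.Coprime r) :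
    (q * q.minFac).Coprime r :=
  Nat.Coprime.mul_left h (Nat.Coprime.coprime_dvd_left (Nat.minFac_dvd q) h)

lemma dvd_ite_mul {a b : ℕ} (h : a.Coprime b) (n : ℕ) :
    (if a ∣ n then (1 : ℝ) else 0) * (if b ∣ n then 1 else 0) = if a * b ∣ n then 1 else 0 := by
  have : a * b ∣ n ↔ a ∣ n ∧ b ∣ n :=
    ⟨fun h3 => ⟨(Dvd.intro _ rfl).trans h3, (Dvd.intro_left _ rfl).trans h3⟩,
      fun h3 => h.mul_dvd_of_dvd_of_dvd h3.1 h3.2⟩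
  simp only [this, ite_zero_mul_ite_zero, one_mul]

lemma abs_sum_exactDvd_pair_sub_le {X : ℝ} (hX : 0 ≤ X) {q r : ℕ} (h : q.Coprime r) :
    |∑ n ∈ Icc 1 ⌊X⌋₊, (if ExactDvd q n then (1 : ℝ) else 0) * (if ExactDvd r n then 1 else 0) -
      X * (exactDensity q * exactDensity r)| ≤ 4 := by
  have hq' := coprime_mul_minFac h
  have hr' := (coprime_mul_minFac h.symm).symm
  have hqr := coprime_mul_minFac hr'
  simp_rw [exactDvd_ite, sub_mul, mul_sub, dvd_ite_mul h, dvd_ite_mul hq', dvd_ite_mul hr',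
    dvd_ite_mul hqr]
  rw [sum_sub_distrib, sum_sub_distrib, sum_sub_distrib]
  have h1 := abs_le.1 (abs_sum_dvd_sub_le hX (q * r))
  have h2 := abs_le.1 (abs_sum_dvd_sub_le hX (q * q.minFac * r))
  have h3 := abs_le.1 (abs_sum_dvd_sub_le hX (q * (r * r.minFac)))
  have h4 := abs_le.1 (abs_sum_dvd_sub_le hX (q * q.minFac * (r * r.minFac)))
  have e : X * (exactDensity q * exactDensity r) = X / ((q * r : ℕ) : ℝ) -
      X / ((q * q.minFac * r : ℕ) : ℝ) - X / ((q * (r * r.minFac) : ℕ) : ℝ) +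
      X / ((q * q.minFac * (r * r.minFac) : ℕ) : ℝ) := by
    rw [exactDensity, exactDensity]
    push_cast
    simp only [div_eq_mul_inv, mul_inv, one_mul]
    ring
  rw [e, abs_le]
  constructor <;> linarith

lemma exactDvd_pair_eq_zero {q r n : ℕ} (hq : IsPrimePow q) (hr : IsPrimePow r) (hn : n ≠ 0)
    (hne : r ≠ q) (hc : ¬ q.Coprime r) (h1 : ExactDvd q n) (h2 : ExactDvd r n) : False := by
  obtain ⟨p, k, hp, hk, rfl⟩ := hq
  obtain ⟨p', k', hp', hk', rfl⟩ := hr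
  have hpp : p = p' := by
    by_contra hpp
    exact hc (Nat.Coprime.pow _ _ ((Nat.coprime_primes hp.nat_prime hp'.nat_prime).2 hpp))
  subst hpp
  rw [exactDvd_prime_pow_iff hp.nat_prime hk.ne' hn] at h1
  rw [exactDvd_prime_pow_iff hp.nat_prime hk'.ne' hn] at h2
  exact hne (by rw [← h1, ← h2])

/-- Counting integers exactly divisible by two prime powers. -/
lemma abs_exactDvd_pair_sub_le {X : ℝ} (hX : 0 ≤ X) {q r : ℕ} (hq : q ∈ ppowsUpTo ⌊X⌋₊)
    (hr : r ∈ ppowsUpTo ⌊X⌋₊) :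
    |∑ n ∈ Icc 1 ⌊X⌋₊, (if ExactDvd q n then (1 : ℝ) else 0) * (if ExactDvd r n then 1 else 0) -
      ((if r = q then X * exactDensity q else 0) +
        (if r * q ≤ ⌊X⌋₊ then X * (exactDensity q * exactDensity r) else 0))| ≤
      (if r = q then 2 else 0) + (if r * q ≤ ⌊X⌋₊ then 4 else 0) +
        (if q.Coprime r then 0 else X / q * (1 / r)) := by
  rw [mem_ppowsUpTo] at hq hr
  have hdd : X * (exactDensity q * exactDensity r) ≤ X / q * (1 / r) := by
    have h1 := exactDensity_le q
    have h2 := exactDensity_le r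
    have h3 := exactDensity_nonneg q
    have h4 := exactDensity_nonneg r
    calc _ ≤ X * (1 / q * (1 / r)) := by gcongr
      _ = _ := by ring
  have hdd0 : 0 ≤ X * (exactDensity q * exactDensity r) :=
    mul_nonneg hX (mul_nonneg (exactDensity_nonneg q) (exactDensity_nonneg r))
  by_cases hrq : r = q
  · subst hrq
    have hnc : ¬ r.Coprime r := by
      rw [Nat.coprime_self]
      omega
    have e : ∑ n ∈ Icc 1 ⌊X⌋₊,
        (if ExactDvd r n then (1 : ℝ) else 0) * (if ExactDvd r n then 1 else 0) =
        ∑ n ∈ Icc 1 ⌊X⌋₊, (if ExactDvd r n then (1 : ℝ) else 0) :=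
      sum_congr rfl fun n _ => by split_ifs <;> simp
    rw [e]
    have h1 := abs_le.1 (abs_sum_exactDvd_sub_le hX r)
    rw [if_pos rfl, if_pos rfl, if_neg hnc, abs_le]
    split_ifs <;> constructor <;> linarith
  · simp only [hrq, if_false, zero_add]
    by_cases hc : q.Coprime r
    · rw [if_pos hc, add_zero]
      split_ifs with hle
      · exact abs_sum_exactDvd_pair_sub_le hX hc
      · rw [sub_zero, sum_eq_zero, abs_zero]
        intro n hn
        rw [mem_Icc] at hn
        by_cases h1 : ExactDvd q n <;> by_cases h2 : ExactDvd r n <;> simp [h1, h2]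
        have := Nat.le_of_dvd (by omega) (hc.symm.mul_dvd_of_dvd_of_dvd h2.1 h1.1)
        omega
    · rw [if_neg hc]
      rw [sum_eq_zero]
      · rw [abs_le]
        split_ifs <;> constructor <;> linarith
      · intro n hn
        rw [mem_Icc] at hn
        by_cases h1 : ExactDvd q n <;> by_cases h2 : ExactDvd r n <;> simp [h1, h2]
        exact exactDvd_pair_eq_zero hq.2 hr.2 (by omega) hrq hc h1 h2

lemma Ag_eq_sum (g : ℕ → ℂ) (X : ℝ) :
    Ag g X = ∑ r ∈ ppowsUpTo ⌊X⌋₊, g r * (exactDensity r : ℂ) := by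
  refine sum_congr rfl fun r _ => ?_
  rw [exactDensity]
  push_cast
  ring

lemma Ag_div_eq_sum (g : ℕ → ℂ) (X : ℝ) {q : ℕ} (hq : 0 < q) :
    Ag g (X / q) = ∑ r ∈ ppowsUpTo ⌊X⌋₊,
      if r * q ≤ ⌊X⌋₊ then g r * (exactDensity r : ℂ) else 0 := by
  rw [Ag_eq_sum, Nat.floor_div_natCast, ← sum_filter]
  refine sum_congr ?_ fun _ _ => rfl
  ext r
  simp only [mem_filter, mem_ppowsUpTo, Nat.le_div_iff_mul_le hq]
  constructor
  · rintro ⟨⟨a, b⟩, c⟩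
    exact ⟨⟨⟨a, (Nat.le_mul_of_pos_right r hq).trans b⟩, c⟩, b⟩
  · rintro ⟨⟨⟨a, b⟩, c⟩, d⟩
    exact ⟨⟨a, d⟩, c⟩

lemma norm_Ag_le (g : ℕ → ℂ) (X : ℝ) :
    ‖Ag g X‖ ≤ ∑ r ∈ ppowsUpTo ⌊X⌋₊, ‖g r‖ / r := by
  rw [Ag_eq_sum]
  refine (norm_sum_le _ _).trans (sum_le_sum fun r _ => ?_)
  rw [norm_mul, Complex.norm_real, Real.norm_of_nonneg (exactDensity_nonneg r),
    div_eq_mul_one_div]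
  gcongr
  exact exactDensity_le r

lemma IsAdditive.eq_sum {g : ℕ → ℂ} (hg : IsAdditive g) {n N : ℕ} (hn : 1 ≤ n) (hnN : n ≤ N) :
    g n = ∑ r ∈ ppowsUpTo N, g r * (if ExactDvd r n then 1 else 0) := by
  rw [eq_primePowSum (fun m n _ _ => hg m n) (by omega : n ≠ 0),
    ← sum_exactDvd_eq_primePowSum g hn hnN, sum_filter]
  exact sum_congr rfl fun r _ => by simp

lemma norm_sum_sub_le {g : ℕ → ℂ} (hg : IsAdditive g) {X : ℝ} (hX : 0 ≤ X) :
    ‖∑ n ∈ Icc 1 ⌊X⌋₊, g n - X * Ag g X‖ ≤ 2 * ∑ r ∈ ppowsUpTo ⌊X⌋₊, ‖g r‖ := by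
  have e : ∑ n ∈ Icc 1 ⌊X⌋₊, g n - X * Ag g X = ∑ r ∈ ppowsUpTo ⌊X⌋₊, g r *
      ((∑ n ∈ Icc 1 ⌊X⌋₊, (if ExactDvd r n then (1 : ℝ) else 0) - X * exactDensity r : ℝ) : ℂ) := by
    rw [sum_congr rfl fun n hn => hg.eq_sum (mem_Icc.1 hn).1 (mem_Icc.1 hn).2, sum_comm,
      Ag_eq_sum, mul_sum, ← sum_sub_distrib]
    refine sum_congr rfl fun r _ => ?_
    rw [← mul_sum]
    push_cast [apply_ite ((↑) : ℝ → ℂ)]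
    ring
  rw [e, mul_sum]
  refine (norm_sum_le _ _).trans (sum_le_sum fun r _ => ?_)
  rw [norm_mul, Complex.norm_real, Real.norm_eq_abs, mul_comm]
  gcongr
  exact abs_sum_exactDvd_sub_le hX r

lemma norm_sum_exactDvd_sub_le {g : ℕ → ℂ} (hg : IsAdditive g) {X : ℝ} (hX : 0 ≤ X) {q : ℕ}
    (hq : q ∈ ppowsUpTo ⌊X⌋₊) :
    ‖∑ n ∈ (Icc 1 ⌊X⌋₊).filter (ExactDvd q ·), g n -
      (X * exactDensity q : ℝ) * (g q + Ag g (X / q))‖ ≤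
      2 * ‖g q‖ + 4 * ∑ r ∈ ppowsUpTo ⌊X⌋₊, (if r * q ≤ ⌊X⌋₊ then ‖g r‖ else 0) +
        X * ∑ r ∈ ppowsUpTo ⌊X⌋₊, (if q.Coprime r then 0 else 1 / q * (‖g r‖ / r)) := by
  have hq0 : 0 < q := by rw [mem_ppowsUpTo] at hq; omega
  set P : ℕ → ℝ := fun r => ∑ n ∈ Icc 1 ⌊X⌋₊,
    (if ExactDvd q n then (1 : ℝ) else 0) * (if ExactDvd r n then 1 else 0) with hP
  set t : ℕ → ℝ := fun r => (if r = q then X * exactDensity q else 0) +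
        (if r * q ≤ ⌊X⌋₊ then X * (exactDensity q * exactDensity r) else 0) with ht
  have e1 : ∑ n ∈ (Icc 1 ⌊X⌋₊).filter (ExactDvd q ·), g n =
      ∑ r ∈ ppowsUpTo ⌊X⌋₊, g r * (P r : ℂ) := by
    rw [sum_filter]
    calc _ = ∑ n ∈ Icc 1 ⌊X⌋₊, ∑ r ∈ ppowsUpTo ⌊X⌋₊,
          g r * ((if ExactDvd q n then 1 else 0) * (if ExactDvd r n then 1 else 0)) := by
          refine sum_congr rfl fun n hn => ?_
          split_ifs with h
          · rw [hg.eq_sum (mem_Icc.1 hn).1 (mem_Icc.1 hn).2]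
            simp
          · simp
      _ = _ := by
          rw [sum_comm]
          refine sum_congr rfl fun r _ => ?_
          rw [← mul_sum, hP]
          push_cast [apply_ite ((↑) : ℝ → ℂ)]
          rfl
  have e2 : ((X * exactDensity q : ℝ) : ℂ) * (g q + Ag g (X / q)) =
      ∑ r ∈ ppowsUpTo ⌊X⌋₊, g r * (t r : ℂ) := by
    have e3 : ∀ r ∈ ppowsUpTo ⌊X⌋₊, g r * (t r : ℂ) =
        (if r = q then ((X * exactDensity q : ℝ) : ℂ) * g r else 0) +
        ((X * exactDensity q : ℝ) : ℂ) *
          (if r * q ≤ ⌊X⌋₊ then g r * (exactDensity r : ℂ) else 0) := by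
      intro r _
      simp only [ht]
      split_ifs <;> push_cast <;> ring
    rw [sum_congr rfl e3, sum_add_distrib, sum_ite_eq' _ _ _, if_pos hq, ← mul_sum,
      ← Ag_div_eq_sum g X hq0, mul_add]
  rw [e1, e2, ← sum_sub_distrib]
  calc _ ≤ ∑ r ∈ ppowsUpTo ⌊X⌋₊, ‖g r * (P r : ℂ) - g r * (t r : ℂ)‖ := norm_sum_le _ _
    _ ≤ ∑ r ∈ ppowsUpTo ⌊X⌋₊, ((if r = q then 2 * ‖g r‖ else 0) +
          4 * (if r * q ≤ ⌊X⌋₊ then ‖g r‖ else 0) +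
          X * (if q.Coprime r then 0 else 1 / q * (‖g r‖ / r))) := by
        refine sum_le_sum fun r hr => ?_
        have h1 := abs_exactDvd_pair_sub_le hX hq hr
        rw [← mul_sub, ← Complex.ofReal_sub, norm_mul, Complex.norm_real, Real.norm_eq_abs]
        refine (mul_le_mul_of_nonneg_left h1 (norm_nonneg (g r))).trans (le_of_eq ?_)
        split_ifs <;> ring
    _ = _ := by
        rw [sum_add_distrib, sum_add_distrib, sum_ite_eq' _ _ _, if_pos hq, ← mul_sum, ← mul_sum]

/-- The error made in comparing one discrepancy with its dual expression. -/
noncomputable def discrepancyError (g : ℕ → ℂ) (X : ℝ) (q : ℕ) : ℝ :=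
  2 * ‖g q‖ + 4 * ∑ r ∈ ppowsUpTo ⌊X⌋₊, (if r * q ≤ ⌊X⌋₊ then ‖g r‖ else 0) +
    X * ∑ r ∈ ppowsUpTo ⌊X⌋₊, (if q.Coprime r then 0 else 1 / q * (‖g r‖ / r)) +
    1 / q * (2 * ∑ r ∈ ppowsUpTo ⌊X⌋₊, ‖g r‖) + 3 * ∑ r ∈ ppowsUpTo ⌊X⌋₊, ‖g r‖ / r

lemma norm_discrepancy_div_le {g : ℕ → ℂ} (hg : IsAdditive g) {X : ℝ} (hX : 0 < X) {q : ℕ}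
    (hq : q ∈ ppowsUpTo ⌊X⌋₊) :
    ‖g q - Ag g X + Ag g (X / q)‖ / q ≤
      2 / X * (‖∑ n ∈ (Icc 1 ⌊X⌋₊).filter (ExactDvd q ·), (g n - Ag g X) -
        exactDensity q * ∑ n ∈ Icc 1 ⌊X⌋₊, (g n - Ag g X)‖ + discrepancyError g X q) := by
  have hq2 : 2 ≤ q := by rw [mem_ppowsUpTo] at hq; omega
  have hq1 : (1 : ℝ) / q ≤ 1 := by
    rw [div_le_one (by positivity)]
    exact_mod_cast (by omega : 1 ≤ q)
  have hw0 := exactDensity_nonneg q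
  have hwq := exactDensity_le q
  set w := exactDensity q with hw
  set A := Ag g X with hA
  set D := ∑ n ∈ (Icc 1 ⌊X⌋₊).filter (ExactDvd q ·), (g n - A) -
        w * ∑ n ∈ Icc 1 ⌊X⌋₊, (g n - A) with hD
  have h1 := norm_sum_exactDvd_sub_le hg hX.le hq
  have h2 := norm_sum_sub_le hg hX.le
  have h3 := abs_sum_exactDvd_sub_le hX.le q
  have h4 := norm_Ag_le g X
  rw [← hA] at h2 h4
  rw [← hw] at h1 h3
  set e₁ := ∑ n ∈ (Icc 1 ⌊X⌋₊).filter (ExactDvd q ·), g n - (X * w : ℝ) * (g q + Ag g (X / q))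
    with he₁
  set e₃ := ∑ n ∈ Icc 1 ⌊X⌋₊, g n - X * A with he₃
  set e₂ : ℝ := ∑ n ∈ Icc 1 ⌊X⌋₊, (if ExactDvd q n then (1 : ℝ) else 0) - X * w with he₂
  set e₄ : ℝ := X - ⌊X⌋₊ with he₄
  have h5 : |e₄| ≤ 1 := by
    have := Nat.floor_le hX.le
    have := Nat.lt_floor_add_one X
    rw [abs_le]
    constructor <;> linarith
  have hDe : ((X * w : ℝ) : ℂ) * (g q - A + Ag g (X / q)) =
      D - e₁ + A * (e₂ : ℂ) + (w : ℂ) * e₃ + (w * e₄ : ℝ) * A := by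
    rw [hD, he₁, he₂, he₃, he₄, sum_sub_distrib, sum_sub_distrib, sum_const, sum_const,
      Nat.card_Icc, sum_boole]
    simp only [nsmul_eq_mul, Nat.add_sub_cancel]
    push_cast
    ring
  have hnorm : X * w * ‖g q - A + Ag g (X / q)‖ ≤ ‖D‖ + discrepancyError g X q := by
    have e : X * w * ‖g q - A + Ag g (X / q)‖ = ‖((X * w : ℝ) : ℂ) * (g q - A + Ag g (X / q))‖ := by
      rw [norm_mul, Complex.norm_real, Real.norm_of_nonneg (by positivity)]
    rw [e, hDe]
    have b2 : ‖A * (e₂ : ℂ)‖ ≤ 2 * ∑ r ∈ ppowsUpTo ⌊X⌋₊, ‖g r‖ / r := by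
      rw [norm_mul, Complex.norm_real, Real.norm_eq_abs, mul_comm]
      gcongr
    have b3 : ‖(w : ℂ) * e₃‖ ≤ 1 / q * (2 * ∑ r ∈ ppowsUpTo ⌊X⌋₊, ‖g r‖) := by
      rw [norm_mul, Complex.norm_real, Real.norm_of_nonneg hw0]
      gcongr
    have b4 : ‖((w * e₄ : ℝ) : ℂ) * A‖ ≤ 1 * ∑ r ∈ ppowsUpTo ⌊X⌋₊, ‖g r‖ / r := by
      rw [norm_mul, Complex.norm_real, Real.norm_eq_abs, abs_mul, abs_of_nonneg hw0]
      have : w * |e₄| ≤ 1 := mul_le_one₀ (hwq.trans hq1) (abs_nonneg _) h5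
      gcongr
    have t1 := norm_add_le (D - e₁ + A * (e₂ : ℂ) + (w : ℂ) * e₃) ((w * e₄ : ℝ) * A)
    have t2 := norm_add_le (D - e₁ + A * (e₂ : ℂ)) ((w : ℂ) * e₃)
    have t3 := norm_add_le (D - e₁) (A * (e₂ : ℂ))
    have t4 := norm_sub_le D e₁
    rw [discrepancyError]
    linarith
  have hwlow := half_inv_le_exactDensity hq2
  rw [← hw] at hwlow
  calc _ = 1 / q * ‖g q - A + Ag g (X / q)‖ := by ring
    _ ≤ 2 * w * ‖g q - A + Ag g (X / q)‖ := by gcongr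
    _ = 2 / X * (X * w * ‖g q - A + Ag g (X / q)‖) := by field_simp
    _ ≤ _ := by gcongr

lemma exists_sum_not_coprime_le :
    ∃ C : ℝ, 0 < C ∧ ∀ N r : ℕ, IsPrimePow r →
      ∑ q ∈ (ppowsUpTo N).filter (fun q => ¬ q.Coprime r), Real.log q / q ≤ C := by
  obtain ⟨C, hC, h⟩ := exists_sum_proper_log_div_le
  refine ⟨1 + C, by positivity, fun N r hr => ?_⟩
  rw [← sum_filter_add_sum_filter_not _ Nat.Prime]
  have hnn : ∀ q : ℕ, 0 ≤ Real.log q / q := fun q => by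
    have := Real.log_natCast_nonneg q
    positivity
  refine add_le_add ?_ (le_trans ?_ (h N))
  · have hr1 : r ≠ 1 := hr.ne_one
    have hsub : ((ppowsUpTo N).filter (fun q => ¬ q.Coprime r)).filter Nat.Prime ⊆ {r.minFac} := by
      intro p hp
      rw [mem_filter, mem_filter] at hp
      obtain ⟨p', k, hp', hk, rfl⟩ := hr
      have hd : p ∣ p' ^ k := by
        by_contra hnd
        exact hp.1.2 ((Nat.Prime.coprime_iff_not_dvd hp.2).2 hnd)
      rw [mem_singleton, Nat.Prime.pow_minFac hp'.nat_prime hk.ne']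
      exact (Nat.prime_dvd_prime_iff_eq hp.2 hp'.nat_prime).1 (hp.2.dvd_of_dvd_pow hd)
    refine (sum_le_sum_of_subset_of_nonneg hsub fun q _ _ => hnn q).trans ?_
    rw [sum_singleton]
    have h0 : (0 : ℝ) < r.minFac := by exact_mod_cast Nat.minFac_pos r
    rw [div_le_one h0]
    linarith [Real.log_le_sub_one_of_pos h0]
  · refine sum_le_sum_of_subset_of_nonneg ?_ fun q _ _ => hnn q
    intro q hq
    rw [mem_filter, mem_filter] at hq
    exact mem_filter.2 ⟨hq.1.1, hq.2⟩

lemma exists_sum_discrepancyError_le :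
    ∃ C : ℝ, 0 < C ∧ ∀ (g : ℕ → ℂ) (X t : ℝ) (Q : Finset ℕ), 0 ≤ X → 0 < t →
      Q ⊆ ppowsUpTo ⌊X⌋₊ → (∀ q ∈ Q, t ≤ Real.log q) →
      ∑ q ∈ Q, discrepancyError g X q ≤
        C * ((1 + ∑ q ∈ ppowsUpTo ⌊X⌋₊, 1 / (q : ℝ)) * ∑ r ∈ ppowsUpTo ⌊X⌋₊, ‖g r‖ +
          X / t * ∑ r ∈ ppowsUpTo ⌊X⌋₊, ‖g r‖ / r) := by
  obtain ⟨C₁, hC₁, h₁⟩ := exists_sum_log_ppowsUpTo_le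
  obtain ⟨C₂, hC₂, h₂⟩ := exists_sum_not_coprime_le
  refine ⟨2 + 7 * C₁ + C₂, by positivity, fun g X t Q hX ht hQ hQt => ?_⟩
  set N := ⌊X⌋₊ with hN
  set S := ppowsUpTo N with hS
  have hNX : (N : ℝ) ≤ X := Nat.floor_le hX
  have hT0 : 0 ≤ ∑ r ∈ S, ‖g r‖ := sum_nonneg fun _ _ => norm_nonneg _
  have hV0 : 0 ≤ ∑ r ∈ S, ‖g r‖ / r := sum_nonneg fun _ _ => by positivity
  have hM0 : 0 ≤ ∑ q ∈ S, 1 / (q : ℝ) := sum_nonneg fun _ _ => by positivity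
  have hcount : ∀ r : ℕ, 0 < r → ∑ q ∈ Q, (if r * q ≤ N then (1 : ℝ) else 0) ≤ C₁ * (X / t) / r := by
    intro r hr
    have hr' : (0 : ℝ) < r := by exact_mod_cast hr
    have h1 : t * ∑ q ∈ Q, (if r * q ≤ N then (1 : ℝ) else 0) ≤ C₁ * (X / r) := by
      calc _ ≤ ∑ q ∈ Q, (if r * q ≤ N then Real.log q else 0) := by
            rw [mul_sum]
            refine sum_le_sum fun q hq => ?_
            split_ifs
            · simpa using hQt q hq
            · simp
        _ ≤ ∑ q ∈ ppowsUpTo (N / r), Real.log q := by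
            rw [← sum_filter]
            refine sum_le_sum_of_subset_of_nonneg ?_ fun _ _ _ => Real.log_natCast_nonneg _
            intro q hq
            rw [mem_filter] at hq
            have hq' := mem_ppowsUpTo.1 (hQ hq.1)
            rw [mem_ppowsUpTo, Nat.le_div_iff_mul_le hr]
            exact ⟨⟨hq'.1.1, by linarith [hq.2, mul_comm r q]⟩, hq'.2⟩
        _ ≤ C₁ * ((N / r : ℕ) : ℝ) := h₁ _
        _ ≤ C₁ * (X / r) := by
            have : ((N / r : ℕ) : ℝ) ≤ N / r := Nat.cast_div_le
            gcongr
            exact this.trans (by gcongr)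
    calc _ = (t * ∑ q ∈ Q, (if r * q ≤ N then (1 : ℝ) else 0)) / t := by field_simp
      _ ≤ C₁ * (X / r) / t := by gcongr
      _ = _ := by ring
  have p1 : ∑ q ∈ Q, ‖g q‖ ≤ ∑ r ∈ S, ‖g r‖ :=
    sum_le_sum_of_subset_of_nonneg hQ fun _ _ _ => norm_nonneg _
  have p2 : ∑ q ∈ Q, ∑ r ∈ S, (if r * q ≤ N then ‖g r‖ else 0) ≤
      C₁ * (X / t * ∑ r ∈ S, ‖g r‖ / r) := by
    rw [sum_comm, mul_sum, mul_sum]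
    refine sum_le_sum fun r hr => ?_
    have hr0 : 0 < r := by rw [hS, mem_ppowsUpTo] at hr; omega
    calc _ = ‖g r‖ * ∑ q ∈ Q, (if r * q ≤ N then (1 : ℝ) else 0) := by
          rw [mul_sum]
          exact sum_congr rfl fun q _ => by split_ifs <;> simp
      _ ≤ ‖g r‖ * (C₁ * (X / t) / r) := by gcongr; exact hcount r hr0
      _ = _ := by ring
  have p3 : X * ∑ q ∈ Q, ∑ r ∈ S, (if q.Coprime r then 0 else 1 / (q : ℝ) * (‖g r‖ / r)) ≤
      C₂ * (X / t * ∑ r ∈ S, ‖g r‖ / r) := by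
    have : ∑ q ∈ Q, ∑ r ∈ S, (if q.Coprime r then 0 else 1 / (q : ℝ) * (‖g r‖ / r)) ≤
        C₂ / t * ∑ r ∈ S, ‖g r‖ / r := by
      rw [sum_comm, mul_sum]
      refine sum_le_sum fun r hr => ?_
      have hr' := mem_ppowsUpTo.1 hr
      have h3 : t * ∑ q ∈ Q.filter (fun q => ¬ q.Coprime r), 1 / (q : ℝ) ≤ C₂ := by
        refine le_trans ?_ (h₂ N r hr'.2)
        rw [mul_sum]
        calc _ ≤ ∑ q ∈ Q.filter (fun q => ¬ q.Coprime r), Real.log q / q := by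
              refine sum_le_sum fun q hq => ?_
              rw [mul_one_div]
              gcongr
              exact hQt q (mem_filter.1 hq).1
          _ ≤ _ := by
              refine sum_le_sum_of_subset_of_nonneg (filter_subset_filter _ hQ) fun q _ _ => ?_
              have := Real.log_natCast_nonneg q
              positivity
      calc _ = (‖g r‖ / r) * ∑ q ∈ Q.filter (fun q => ¬ q.Coprime r), 1 / (q : ℝ) := by
            rw [mul_sum, sum_filter]
            exact sum_congr rfl fun q _ => by split_ifs <;> simp [mul_comm]
        _ = (‖g r‖ / r) * ((t * ∑ q ∈ Q.filter (fun q => ¬ q.Coprime r), 1 / (q : ℝ)) / t) := by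
            rw [mul_div_cancel_left₀ _ ht.ne']
        _ ≤ (‖g r‖ / r) * (C₂ / t) := by gcongr
        _ = _ := by ring
    calc _ ≤ X * (C₂ / t * ∑ r ∈ S, ‖g r‖ / r) := by gcongr
      _ = _ := by ring
  have p4 : ∑ q ∈ Q, 1 / (q : ℝ) ≤ ∑ q ∈ S, 1 / (q : ℝ) :=
    sum_le_sum_of_subset_of_nonneg hQ fun _ _ _ => by positivity
  have p5 : (#Q : ℝ) ≤ C₁ * (X / t) := by
    have h5 := hcount 1 one_pos
    have e : ∑ q ∈ Q, (if 1 * q ≤ N then (1 : ℝ) else 0) = #Q := by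
      rw [card_eq_sum_ones]
      push_cast
      refine sum_congr rfl fun q hq => ?_
      rw [one_mul, if_pos (mem_ppowsUpTo.1 (hQ hq)).1.2]
    rw [e] at h5
    simpa using h5
  have hsum : ∑ q ∈ Q, discrepancyError g X q = 2 * ∑ q ∈ Q, ‖g q‖ +
      4 * ∑ q ∈ Q, ∑ r ∈ S, (if r * q ≤ N then ‖g r‖ else 0) +
      X * ∑ q ∈ Q, ∑ r ∈ S, (if q.Coprime r then 0 else 1 / (q : ℝ) * (‖g r‖ / r)) +
      (∑ q ∈ Q, 1 / (q : ℝ)) * (2 * ∑ r ∈ S, ‖g r‖) + #Q * (3 * ∑ r ∈ S, ‖g r‖ / r) := by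
    simp only [discrepancyError]
    rw [sum_add_distrib, sum_add_distrib, sum_add_distrib, sum_add_distrib, sum_const,
      nsmul_eq_mul, ← mul_sum, ← mul_sum, ← mul_sum, ← sum_mul]
  have q4 : (∑ q ∈ Q, 1 / (q : ℝ)) * (2 * ∑ r ∈ S, ‖g r‖) ≤
      (∑ q ∈ S, 1 / (q : ℝ)) * (2 * ∑ r ∈ S, ‖g r‖) := by gcongr
  have q5 : #Q * (3 * ∑ r ∈ S, ‖g r‖ / r) ≤ C₁ * (X / t) * (3 * ∑ r ∈ S, ‖g r‖ / r) := by gcongr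
  rw [hsum]
  set T := ∑ r ∈ S, ‖g r‖
  set V := ∑ r ∈ S, ‖g r‖ / r
  set M₁ := ∑ q ∈ S, 1 / (q : ℝ)
  have r1 : 0 ≤ X / t * V := by positivity
  have r2 : 0 ≤ (1 + M₁) * T := by positivity
  have r3 : 0 ≤ (7 * C₁ + C₂) * ((1 + M₁) * T) := by positivity
  linarith

lemma exists_sum_ppowsUpTo_le :
    ∃ C : ℝ, 0 < C ∧ ∀ X : ℝ, 1 < X → ∑ r ∈ ppowsUpTo ⌊X⌋₊, (r : ℝ) ≤ C * (X ^ 2 / Real.log X) := by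
  obtain ⟨C, hC, h⟩ := exists_sum_log_ppowsUpTo_le
  refine ⟨3 * C, by positivity, fun X hX => ?_⟩
  have hl : 0 < Real.log X := Real.log_pos hX
  have hX0 : 0 < X := by linarith
  have h1 : (∑ r ∈ ppowsUpTo ⌊X⌋₊, (r : ℝ)) * Real.log X ≤
      3 * X * ∑ r ∈ ppowsUpTo ⌊X⌋₊, Real.log r := by
    rw [sum_mul, mul_sum]
    refine sum_le_sum fun r hr => ?_
    rw [mem_ppowsUpTo] at hr
    have hr2 : (2 : ℝ) ≤ r := by exact_mod_cast hr.1.1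
    have hr0 : (0 : ℝ) < r := by linarith
    have hrX : (r : ℝ) ≤ X := (Nat.le_floor_iff hX0.le).1 hr.1.2
    have h2 : Real.log (X / r) ≤ X / r :=
      (Real.log_le_sub_one_of_pos (by positivity)).trans (by linarith)
    rw [Real.log_div hX0.ne' hr0.ne', le_div_iff₀ hr0] at h2
    have h3 : Real.log 2 ≤ Real.log r := Real.log_le_log two_pos hr2
    have h4 := Real.log_two_gt_d9
    have h5 : (r : ℝ) * Real.log r ≤ X * Real.log r := by
      gcongr
    nlinarith
  have h2 : 3 * X * ∑ r ∈ ppowsUpTo ⌊X⌋₊, Real.log r ≤ 3 * X * (C * X) := by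
    gcongr
    refine (h _).trans ?_
    gcongr
    exact Nat.floor_le hX0.le
  rw [← mul_div_assoc, le_div_iff₀ hl]
  linarith

lemma sum_norm_div_le (g : ℕ → ℂ) (X : ℝ) :
    ∑ r ∈ ppowsUpTo ⌊X⌋₊, ‖g r‖ / r ≤ Bg g X * √(∑ r ∈ ppowsUpTo ⌊X⌋₊, 1 / (r : ℝ)) := by
  have := Real.sum_mul_le_sqrt_mul_sqrt (ppowsUpTo ⌊X⌋₊) (fun r => ‖g r‖ / √(r : ℝ))
    (fun r => 1 / √(r : ℝ))
  have e : ∀ r : ℕ, ‖g r‖ / √(r : ℝ) * (1 / √(r : ℝ)) = ‖g r‖ / r := fun r => by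
    rw [div_mul_div_comm, mul_one, Real.mul_self_sqrt (by positivity)]
  simp_rw [e, div_pow, one_pow, Real.sq_sqrt (Nat.cast_nonneg _)] at this
  exact this

lemma sum_norm_le (g : ℕ → ℂ) (X : ℝ) :
    ∑ r ∈ ppowsUpTo ⌊X⌋₊, ‖g r‖ ≤ Bg g X * √(∑ r ∈ ppowsUpTo ⌊X⌋₊, (r : ℝ)) := by
  have := Real.sum_mul_le_sqrt_mul_sqrt (ppowsUpTo ⌊X⌋₊) (fun r => ‖g r‖ / √(r : ℝ))
    (fun r => √(r : ℝ))
  have e : ∀ r ∈ ppowsUpTo ⌊X⌋₊, ‖g r‖ / √(r : ℝ) * √(r : ℝ) = ‖g r‖ := fun r hr => by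
    have : (0 : ℝ) < r := by
      rw [mem_ppowsUpTo] at hr
      exact_mod_cast (by omega : 0 < r)
    exact div_mul_cancel₀ _ (by positivity)
  rw [sum_congr rfl e] at this
  simp_rw [div_pow, Real.sq_sqrt (Nat.cast_nonneg _)] at this
  exact this

lemma window_bounds {X δ : ℝ} (hX : 1 < X) (hl1 : 1 < Real.log X)
    (hll : 2 ≤ Real.log (Real.log X))
    (hδ : Real.log (Real.log X) / √(Real.log X) < δ) (hδ4 : δ ≤ 1 / 4) :
    0 < δ ∧ √(Real.log X) ≤ δ * Real.log X ∧ 2 ≤ ⌊X ^ δ⌋₊ ∧ ⌊X ^ δ⌋₊ ≤ ⌊X⌋₊ ∧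
      1 ≤ 2 * Real.log (1 / δ) ∧
      Real.log (Real.log ⌊X⌋₊) - Real.log (Real.log ⌊X ^ δ⌋₊) ≤ 2 * Real.log (1 / δ) := by
  set l := Real.log X with hl
  have hX0 : 0 < X := by linarith
  have hl0 : 0 < l := by linarith
  have hs : 0 < √l := Real.sqrt_pos.2 hl0
  have hss : √l * √l = l := Real.mul_self_sqrt hl0.le
  have hs1 : 1 ≤ √l := Real.one_le_sqrt.2 hl1.le
  have hδ0 : 0 < δ := lt_of_le_of_lt (by positivity) hδ
  have h1 : 2 ≤ δ * √l := by
    rw [div_lt_iff₀ hs] at hδ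
    linarith
  have h2 : 2 * √l ≤ δ * l := by nlinarith
  have hlog4 : Real.log 4 < 2 := by
    rw [show (4 : ℝ) = 2 ^ 2 by norm_num, Real.log_pow]
    have := Real.log_two_lt_d9
    push_cast
    linarith
  have hy : Real.log (X ^ δ) = δ * l := Real.log_rpow hX0 δ
  have hy0 : 0 < X ^ δ := by positivity
  have hy4 : 4 ≤ X ^ δ := by
    rw [← Real.log_le_log_iff (by norm_num) hy0, hy]
    linarith
  have hM : 2 ≤ ⌊X ^ δ⌋₊ := Nat.le_floor (by push_cast; linarith)
  have hyX : X ^ δ ≤ X := by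
    conv_rhs => rw [← Real.rpow_one X]
    exact Real.rpow_le_rpow_of_exponent_le hX.le (by linarith)
  have hMN : ⌊X ^ δ⌋₊ ≤ ⌊X⌋₊ := Nat.floor_mono hyX
  have hlogδ : Real.log 4 ≤ Real.log (1 / δ) := by
    refine Real.log_le_log (by norm_num) ?_
    rw [le_div_iff₀ hδ0]
    linarith
  have hlog4' : Real.log 4 = 2 * Real.log 2 := by
    rw [show (4 : ℝ) = 2 ^ 2 by norm_num, Real.log_pow]
    norm_num
  have hlog2 := Real.log_two_gt_d9
  refine ⟨hδ0, by linarith, hM, hMN, by linarith, ?_⟩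
  have hN2 : (2 : ℝ) ≤ ⌊X⌋₊ := by exact_mod_cast hM.trans hMN
  have hlogN : Real.log (Real.log ⌊X⌋₊) ≤ Real.log l := by
    refine Real.log_le_log (Real.log_pos (by linarith)) ?_
    exact Real.log_le_log (by linarith) (Nat.floor_le hX0.le)
  have hlogM : δ * l / 2 ≤ Real.log ⌊X ^ δ⌋₊ := by
    have h3 : X ^ δ - 1 < ⌊X ^ δ⌋₊ := Nat.sub_one_lt_floor _
    have h4 : X ^ δ ≤ (⌊X ^ δ⌋₊ : ℝ) ^ 2 := by nlinarith
    have h5 := Real.log_le_log hy0 h4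
    rw [Real.log_pow, hy] at h5
    push_cast at h5
    linarith
  have hlogM' : Real.log (δ * l / 2) ≤ Real.log (Real.log ⌊X ^ δ⌋₊) :=
    Real.log_le_log (by positivity) hlogM
  rw [Real.log_div (by positivity) two_ne_zero, Real.log_mul hδ0.ne' hl0.ne'] at hlogM'
  rw [one_div, Real.log_inv] at hlogδ ⊢
  linarith

lemma ppows_filter_lt_eq_ppowsBetween {X δ : ℝ} (hX : 0 ≤ X) :
    (ppows X).filter (fun q : ℕ => X ^ δ < (q : ℝ)) = ppowsBetween ⌊X ^ δ⌋₊ ⌊X⌋₊ := by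
  refine filter_congr fun q _ => ?_
  rw [Nat.floor_lt (by positivity)]

lemma mul_rpow_mul_rpow_le {α β X S : ℝ} (hαβ : α.HolderConjugate β) (hX : 0 < X) (hS : 0 ≤ S) :
    1 / X * ((⌊X⌋₊ : ℝ) ^ (1 / β) * S ^ (1 / α)) ≤ (1 / X * S) ^ (1 / α) := by
  have hβ : 0 < β := hαβ.symm.pos
  have h1 : (⌊X⌋₊ : ℝ) ^ (1 / β) ≤ X ^ (1 / β) :=
    Real.rpow_le_rpow (by positivity) (Nat.floor_le hX.le) (by positivity)
  rw [Real.mul_rpow (by positivity) hS, ← mul_assoc]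
  gcongr
  have h2 : (1 / X) ^ (1 / α) = 1 / X * X ^ (1 / β) := by
    rw [one_div X, Real.inv_rpow hX.le, ← Real.rpow_neg hX.le, ← Real.rpow_neg_one X,
      ← Real.rpow_add hX]
    congr 1
    have := hαβ.inv_add_inv_eq_one
    simp only [one_div]
    linarith
  rw [h2]
  gcongr

/-- The discrepancy errors over prime powers exceeding `X ^ δ` contribute
`O(X · B_g(X) / (log X)^{1/4})`. -/
lemma exists_sum_discrepancyError_le_Bg :
    ∃ C : ℝ, 0 < C ∧ ∃ X₀ : ℝ, ∀ (g : ℕ → ℂ) (X t : ℝ) (Q : Finset ℕ), X₀ ≤ X →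
      √(Real.log X) ≤ t → Q ⊆ ppowsUpTo ⌊X⌋₊ → (∀ q ∈ Q, t ≤ Real.log q) →
      ∑ q ∈ Q, discrepancyError g X q ≤
        C * X * (Bg g X / (Real.log X) ^ ((1 : ℝ) / 4)) := by
  obtain ⟨C₁, hC₁, h₁⟩ := exists_sum_discrepancyError_le
  obtain ⟨C₂, hC₂, h₂⟩ := exists_sum_ppowsUpTo_le
  obtain ⟨C₃, hC₃, h₃⟩ := exists_sum_inv_ppowsUpTo_le
  refine ⟨C₁ * (9 * √C₂ + 8), by positivity, Real.exp (Real.exp (C₃ + 2)), ?_⟩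
  intro g X t Q hX ht hQ hQt
  have hX0 : 0 < X := (Real.exp_pos _).trans_le hX
  have hle : Real.exp (C₃ + 2) ≤ Real.log X := (Real.le_log_iff_exp_le hX0).2 hX
  set l := Real.log X with hl
  have hl0 : 0 < l := (Real.exp_pos _).trans_le hle
  have hll : C₃ + 2 ≤ Real.log l := (Real.le_log_iff_exp_le hl0).2 hle
  have hl3 : 2 ≤ l := by linarith [Real.add_one_le_exp (C₃ + 2)]
  have hX2 : 2 ≤ X := by
    have := Real.add_one_le_exp l
    rw [hl, Real.exp_log hX0] at this
    linarith
  have hN : 2 ≤ ⌊X⌋₊ := Nat.le_floor (by exact_mod_cast hX2)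
  have hN2 : (2 : ℝ) ≤ ⌊X⌋₊ := by exact_mod_cast hN
  have hM₁ : ∑ r ∈ ppowsUpTo ⌊X⌋₊, 1 / (r : ℝ) ≤ 2 * Real.log l := by
    refine (h₃ _ hN).trans ?_
    have : Real.log (Real.log ⌊X⌋₊) ≤ Real.log l := by
      refine Real.log_le_log (Real.log_pos (by linarith)) ?_
      exact Real.log_le_log (by linarith) (Nat.floor_le hX0.le)
    linarith
  set m := l ^ ((1 : ℝ) / 4) with hm
  have hm0 : 0 < m := by positivity
  have hmm : m * m = √l := by
    rw [hm, ← Real.rpow_add hl0, Real.sqrt_eq_rpow]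
    norm_num
  have hm1 : 1 ≤ m := Real.one_le_rpow (by linarith) (by norm_num)
  have hlm : Real.log l ≤ 4 * m := log_le_four_mul_rpow hl0.le
  have hB : 0 ≤ Bg g X := Real.sqrt_nonneg _
  have hT : ∑ r ∈ ppowsUpTo ⌊X⌋₊, ‖g r‖ ≤ Bg g X * (√C₂ * (X / (m * m))) := by
    refine (sum_norm_le g X).trans ?_
    gcongr
    refine (Real.sqrt_le_sqrt (h₂ X (by linarith))).trans_eq ?_
    rw [Real.sqrt_mul hC₂.le, Real.sqrt_div (by positivity), Real.sqrt_sq hX0.le, hmm]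
  have hV : ∑ r ∈ ppowsUpTo ⌊X⌋₊, ‖g r‖ / r ≤ Bg g X * (8 * m) := by
    refine (sum_norm_div_le g X).trans ?_
    gcongr
    rw [Real.sqrt_le_left (by positivity)]
    nlinarith
  have ht0 : 0 < t := (Real.sqrt_pos.2 hl0).trans_le ht
  refine (h₁ g X t Q hX0.le ht0 hQ hQt).trans ?_
  have hTm : (1 + ∑ q ∈ ppowsUpTo ⌊X⌋₊, 1 / (q : ℝ)) * ∑ r ∈ ppowsUpTo ⌊X⌋₊, ‖g r‖ ≤
      9 * m * (Bg g X * (√C₂ * (X / (m * m)))) := by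
    gcongr
    linarith
  have hVm : X / t * ∑ r ∈ ppowsUpTo ⌊X⌋₊, ‖g r‖ / r ≤ X / (m * m) * (Bg g X * (8 * m)) := by
    rw [← hmm] at ht
    gcongr
  calc _ ≤ C₁ * (9 * m * (Bg g X * (√C₂ * (X / (m * m)))) +
        X / (m * m) * (Bg g X * (8 * m))) := by gcongr
    _ = _ := by
      field_simp

/-- For `α ∈ (1,2)` and `(log log X)/√(log X) < δ ≤ 1/4`,
`∑_{X^δ < p^k ≤ X} |g(p^k) - A_g(X) + A_g(X/p^k)|/p^k
  ≪_α (log(1/δ))^{1/2} ((1/X) ∑_{n ≤ X} |g(n) - A_g(X)|^α)^{1/α} + B_g(X)/(log X)^{1/4}`. -/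
theorem stmt16 (α : ℝ) (hα1 : 1 < α) (hα2 : α < 2) :
    ∃ C : ℝ, 0 < C ∧ ∃ X₀ : ℝ, ∀ X : ℝ, X₀ ≤ X → ∀ (g : ℕ → ℂ), IsAdditive g →
      ∀ δ : ℝ, Real.log (Real.log X) / Real.sqrt (Real.log X) < δ → δ ≤ 1 / 4 →
      ∑ q ∈ (ppows X).filter (fun q : ℕ => X ^ δ < (q : ℝ)),
          ‖g q - Ag g X + Ag g (X / (q : ℝ))‖ / (q : ℝ)
        ≤ C * ((Real.log (1 / δ)) ^ ((1 : ℝ) / 2) *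
            ((1 / X) * ∑ n ∈ Finset.Icc 1 ⌊X⌋₊, ‖g n - Ag g X‖ ^ α) ^ (1 / α)
          + Bg g X / (Real.log X) ^ ((1 : ℝ) / 4)) := by
  have hαβ := Real.HolderConjugate.conjExponent hα1
  obtain ⟨C₁, hC₁, h₁⟩ := exists_dual_le hαβ
  obtain ⟨C₂, hC₂, X₀, h₂⟩ := exists_sum_discrepancyError_le_Bg
  refine ⟨2 * (2 * C₁ + C₂), by positivity, max X₀ (Real.exp (Real.exp 2)), ?_⟩
  intro X hX g hg δ hδ hδ4
  rw [max_le_iff] at hX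
  have hX0 : 0 < X := (Real.exp_pos _).trans_le hX.2
  have hle : Real.exp 2 ≤ Real.log X := (Real.le_log_iff_exp_le hX0).2 hX.2
  have hl0 : 0 < Real.log X := (Real.exp_pos _).trans_le hle
  have hll : 2 ≤ Real.log (Real.log X) := (Real.le_log_iff_exp_le hl0).2 hle
  have hl1 : 1 < Real.log X := by linarith [Real.add_one_le_exp (2 : ℝ)]
  have hX1 : 1 < X := (Real.log_pos_iff hX0.le).1 hl0
  obtain ⟨hδ0, hsqrt, hM, hMN, hL, hW⟩ := window_bounds hX1 hl1 hll hδ hδ4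
  rw [ppows_filter_lt_eq_ppowsBetween hX0.le]
  set S := ∑ n ∈ Icc 1 ⌊X⌋₊, ‖g n - Ag g X‖ ^ α with hS
  have hS0 : 0 ≤ S := by positivity
  have hQ : ppowsBetween ⌊X ^ δ⌋₊ ⌊X⌋₊ ⊆ ppowsUpTo ⌊X⌋₊ := filter_subset _ _
  have herr := h₂ g X (δ * Real.log X) (ppowsBetween ⌊X ^ δ⌋₊ ⌊X⌋₊) hX.1 hsqrt hQ
    fun q hq => by
      rw [← ppows_filter_lt_eq_ppowsBetween hX0.le, mem_filter] at hq
      rw [← Real.log_rpow hX0]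
      exact Real.log_le_log (by positivity) hq.2.le
  have hdual := h₁ _ _ (fun n => g n - Ag g X) _ hM hMN hL hW
  have hlogδ : 0 ≤ Real.log (1 / δ) := by linarith
  have hsqrt2 : (2 : ℝ) ^ ((1 : ℝ) / 2) ≤ 2 := by
    conv_rhs => rw [← Real.rpow_one 2]
    exact Real.rpow_le_rpow_of_exponent_le one_le_two (by norm_num)
  have hmain := mul_rpow_mul_rpow_le hαβ hX0 hS0
  set E := Bg g X / Real.log X ^ ((1 : ℝ) / 4) with hE
  have hE0 : 0 ≤ E := div_nonneg (Real.sqrt_nonneg _) (by positivity)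
  set K := Real.log (1 / δ) ^ ((1 : ℝ) / 2) with hK
  have hK0 : 0 ≤ K := by positivity
  set R := (1 / X * S) ^ (1 / α) with hR
  have hR0 : 0 ≤ R := by positivity
  rw [Real.mul_rpow zero_le_two hlogδ, ← hK, ← hS] at hdual
  calc _ ≤ ∑ q ∈ ppowsBetween ⌊X ^ δ⌋₊ ⌊X⌋₊, 2 / X *
        (‖∑ n ∈ (Icc 1 ⌊X⌋₊).filter (ExactDvd q ·), (g n - Ag g X) -
          exactDensity q * ∑ n ∈ Icc 1 ⌊X⌋₊, (g n - Ag g X)‖ + discrepancyError g X q) :=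
        sum_le_sum fun q hq => norm_discrepancy_div_le hg hX0 (hQ hq)
    _ ≤ 2 / X * (C₁ * (2 ^ ((1 : ℝ) / 2) * K) * (⌊X⌋₊ : ℝ) ^ (1 / α.conjExponent) *
          S ^ (1 / α) + C₂ * X * E) := by
        rw [← mul_sum, sum_add_distrib]
        gcongr
    _ = 2 * C₁ * 2 ^ ((1 : ℝ) / 2) * K *
          (1 / X * ((⌊X⌋₊ : ℝ) ^ (1 / α.conjExponent) * S ^ (1 / α))) + 2 * C₂ * E := by
        field_simp
    _ ≤ 2 * C₁ * 2 * K * R + 2 * C₂ * E := by gcongr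
    _ ≤ _ := by
        have : 0 ≤ C₂ * (K * R) := by positivity
        have : 0 ≤ C₁ * E := by positivity
        nlinarith
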